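/- arXiv:1912.03900 — 2 statements merged into one kernel-verified Lean document; each statement's English description precedes it below -/
import Mathlib

section
/- For every integer d ≥ 4, if P is a 2-neighborly d-polytope with at least d+3 vertices, then every vertex of P is contained in at least d+3 facets of P. -/
open Set

/-- A polytope is the convex hull of a finite set of points. -/
def IsPolytope {N : ℕ} (P : Set (Fin N → ℝ)) : Prop :=
  ∃ S : Finset (Fin N → ℝ), P = convexHull ℝ (S : Set (Fin N → ℝ))

/-- The dimension of a set: the dimension of its affine span. -/
noncomputable def pdim {N : ℕ} (P : Set (Fin N → ℝ)) : ℕ :=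
  Module.finrank ℝ (affineSpan ℝ P).direction

/-- A vertex is a 0-dimensional (exposed) face, i.e. an exposed singleton. -/
def IsVertex {N : ℕ} (P : Set (Fin N → ℝ)) (v : Fin N → ℝ) : Prop :=
  IsExposed ℝ P {v}

/-- The set of vertices of `P`. -/
def vertexSet {N : ℕ} (P : Set (Fin N → ℝ)) : Set (Fin N → ℝ) :=
  {v | IsVertex P v}

/-- A facet is a nonempty exposed face of dimension one less than the polytope. -/
def IsFacetOf {N : ℕ} (P F : Set (Fin N → ℝ)) : Prop :=
  IsExposed ℝ P F ∧ F.Nonempty ∧ pdim F + 1 = pdim P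

/-- The set of facets of `P`. -/
def facetSet {N : ℕ} (P : Set (Fin N → ℝ)) : Set (Set (Fin N → ℝ)) :=
  {F | IsFacetOf P F}

/-- A polytope is 2-neighborly if every pair of distinct vertices is the vertex set of
an edge (1-dimensional face), i.e. the segment between them is an exposed face. -/
def TwoNeighborly {N : ℕ} (P : Set (Fin N → ℝ)) : Prop :=
  ∀ u v : Fin N → ℝ, IsVertex P u → IsVertex P v → u ≠ v →
    IsExposed ℝ P (convexHull ℝ {u, v}) ∧ pdim (convexHull ℝ ({u, v} : Set (Fin N → ℝ))) = 1

/-- A polytope is 2-simplicial if every 2-dimensional face has exactly 3 vertices. -/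
def TwoSimplicial {N : ℕ} (P : Set (Fin N → ℝ)) : Prop :=
  ∀ F : Set (Fin N → ℝ), IsExposed ℝ P F → F.Nonempty → pdim F = 2 →
    (vertexSet F).ncard = 3

/-- A polytope is a pyramid if some vertex (the apex) is not in the affine span
of the remaining vertices. -/
def IsPyramid {N : ℕ} (P : Set (Fin N → ℝ)) : Prop :=
  ∃ v : Fin N → ℝ, IsVertex P v ∧ v ∉ affineSpan ℝ (vertexSet P \ {v})

/-- `P` is a pyramid over `Q`: `Q` is a facet of `P` and `P` is the convex hull of `Q`
together with one additional point (the apex) not in the affine span of `Q`. -/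
def IsPyramidOver {N : ℕ} (P Q : Set (Fin N → ℝ)) : Prop :=
  IsFacetOf P Q ∧ ∃ a : Fin N → ℝ, a ∉ affineSpan ℝ Q ∧ P = convexHull ℝ (Q ∪ {a})

/-- `P` is a `k`-fold pyramid over `Q`. -/
def IsKFoldPyramidOver {N : ℕ} : ℕ → Set (Fin N → ℝ) → Set (Fin N → ℝ) → Prop
  | 0, P, Q => P = Q
  | k + 1, P, Q => ∃ R : Set (Fin N → ℝ), IsKFoldPyramidOver k R Q ∧ IsPyramidOver P R

/-- Nonzero vectors `u j` and functionals `ℓ i` such that the `u j` generate the cone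
`{y | ∀ i, 0 ≤ ℓ i y}`, every `u j` spans an exposed ray of it, and every pair `u j`, `u k` spans
an exposed edge of the convex hull of `0` and the `u j`. -/
structure NeighborlyCone {W I J : Type*} [AddCommGroup W] [Module ℝ W] [Fintype J]
    (u : J → W) (ℓ : I → W →ₗ[ℝ] ℝ) : Prop where
  ne_zero : ∀ j, u j ≠ 0
  nonneg : ∀ i j, 0 ≤ ℓ i (u j)
  mem_cone : ∀ y, (∀ i, 0 ≤ ℓ i y) → ∃ c : J → ℝ, (∀ j, 0 ≤ c j) ∧ y = ∑ j, c j • u j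
  exposed_ray : ∀ j, ∃ g : W →ₗ[ℝ] ℝ, g (u j) = 0 ∧ ∀ k, k ≠ j → g (u k) < 0
  exposed_edge : ∀ j k, j ≠ k → ∃ f : W →ₗ[ℝ] ℝ,
    f (u j) = 1 ∧ f (u k) = 1 ∧ ∀ l, l ≠ j → l ≠ k → f (u l) < 1

/-- The subspace of vectors on which all functionals indexed outside `T` vanish. -/
def coordSubspace {W I : Type*} [AddCommGroup W] [Module ℝ W]
    (ℓ : I → W →ₗ[ℝ] ℝ) (T : Finset I) : Submodule ℝ W where
  carrier := {y | ∀ i, i ∉ T → ℓ i y = 0}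
  add_mem' := by
    intro a b ha hb i hi
    simp [ha i hi, hb i hi]
  zero_mem' := by
    intro i _
    simp
  smul_mem' := by
    intro c a ha i hi
    simp [ha i hi]

/-- The set of indices of functionals that do not vanish at `y`. -/
noncomputable def coordSupport {W I : Type*} [AddCommGroup W] [Module ℝ W] [Fintype I]
    (ℓ : I → W →ₗ[ℝ] ℝ) (y : W) : Finset I :=
  Finset.univ.filter fun i => ℓ i y ≠ 0

section Coordinates

variable {W I : Type*} [AddCommGroup W] [Module ℝ W] {ℓ : I → W →ₗ[ℝ] ℝ}

lemma mem_coordSupport [Fintype I] {y : W} {i : I} : i ∈ coordSupport ℓ y ↔ ℓ i y ≠ 0 := by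
  simp [coordSupport]

lemma mem_coordSubspace_iff [Fintype I] {T : Finset I} {y : W} :
    y ∈ coordSubspace ℓ T ↔ coordSupport ℓ y ⊆ T := by
  constructor
  · intro h i hi
    by_contra hiT
    exact mem_coordSupport.1 hi (h i hiT)
  · intro h i hi
    by_contra hne
    exact hi (h (mem_coordSupport.2 hne))

lemma finrank_coordSubspace_union_le [FiniteDimensional ℝ W] [DecidableEq I] (S B : Finset I) :
    Module.finrank ℝ (coordSubspace ℓ (S ∪ B)) ≤
      Module.finrank ℝ (coordSubspace ℓ S) + B.card := by
  let f : coordSubspace ℓ (S ∪ B) →ₗ[ℝ] (B → ℝ) :=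
    (LinearMap.pi fun i : B => ℓ i).domRestrict _
  have h1 := f.finrank_range_add_finrank_ker
  have h2 : Module.finrank ℝ (LinearMap.range f) ≤ B.card := by
    simpa using (LinearMap.range f).finrank_le
  have h3 : Module.finrank ℝ (LinearMap.ker f) ≤ Module.finrank ℝ (coordSubspace ℓ S) := by
    rw [← Submodule.finrank_map_subtype_eq]
    apply Submodule.finrank_mono
    rintro _ ⟨y, hy, rfl⟩ i hi
    by_cases hB : i ∈ B
    · exact congrFun (LinearMap.mem_ker.1 hy) ⟨i, hB⟩
    · exact y.2 i (by simp [hi, hB])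
  omega

lemma finrank_le_finrank_coordSubspace [FiniteDimensional ℝ W] [Fintype I] [DecidableEq I]
    (T : Finset I) :
    Module.finrank ℝ W + T.card ≤ Module.finrank ℝ (coordSubspace ℓ T) + Fintype.card I := by
  have h := finrank_coordSubspace_union_le (ℓ := ℓ) T Tᶜ
  have htop : coordSubspace ℓ (T ∪ Tᶜ) = ⊤ := by
    rw [eq_top_iff]
    intro y _ i hi
    simp at hi
  rw [htop, finrank_top, Finset.card_compl] at h
  have := T.card_le_univ
  omega

end Coordinates

lemma exists_abs_le_mul {I : Type*} [Fintype I] (a b : I → ℝ) (ha : ∀ i, 0 ≤ a i)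
    (hab : ∀ i, a i = 0 → b i = 0) : ∃ M : ℝ, 0 ≤ M ∧ ∀ i, |b i| ≤ M * a i := by
  refine ⟨∑ i, |b i| / a i, Finset.sum_nonneg fun i _ => div_nonneg (abs_nonneg _) (ha i),
    fun i => ?_⟩
  rcases (ha i).eq_or_lt with h | h
  · simp [hab i h.symm, ← h]
  · rw [← div_le_iff₀ h]
    exact Finset.single_le_sum (f := fun i => |b i| / a i)
      (fun k _ => div_nonneg (abs_nonneg _) (ha k)) (Finset.mem_univ i)

namespace NeighborlyCone

variable {W I J : Type*} [AddCommGroup W] [Module ℝ W] [Fintype J]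
  {u : J → W} {ℓ : I → W →ₗ[ℝ] ℝ}

lemma coeff_eq_zero (h : NeighborlyCone u ℓ) {A : Finset J} {c : J → ℝ}
    (hc : ∑ j ∈ A, c j • u j = 0) (j : J) (hj : ∀ k ∈ A, k ≠ j → c k ≤ 0) :
    ∀ k ∈ A, c k = 0 := by
  obtain ⟨g, hg0, hg⟩ := h.exposed_ray j
  have hs : ∑ k ∈ A, c k * g (u k) = 0 := by
    have := congrArg g hc
    simpa [map_sum] using this
  have hnn : ∀ k ∈ A, 0 ≤ c k * g (u k) := by
    intro k hk
    by_cases hkj : k = j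
    · simp [hkj, hg0]
    · exact mul_nonneg_of_nonpos_of_nonpos (hj k hk hkj) (hg k hkj).le
  have hz := (Finset.sum_eq_zero_iff_of_nonneg hnn).1 hs
  have hne : ∀ k ∈ A, k ≠ j → c k = 0 := fun k hk hkj =>
    (mul_eq_zero.1 (hz k hk)).resolve_right (hg k hkj).ne
  intro k hk
  by_cases hkj : k = j
  · subst hkj
    rw [Finset.sum_eq_single_of_mem k hk fun b hb hbk => by simp [hne b hb hbk]] at hc
    exact (smul_eq_zero.1 hc).resolve_right (h.ne_zero k)
  · exact hne k hk hkj

lemma sum_coeff_neg (h : NeighborlyCone u ℓ) {A : Finset J} {c : J → ℝ}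
    (hc : ∑ j ∈ A, c j • u j = 0) {j k l : J} (hjk : j ≠ k)
    (hneg : ∀ i ∈ A, i ≠ j → i ≠ k → c i ≤ 0) (hl : l ∈ A) (hlc : c l < 0) (hlj : l ≠ j)
    (hlk : l ≠ k) : ∑ i ∈ A, c i < 0 := by
  obtain ⟨f, hfj, hfk, hf⟩ := h.exposed_edge j k hjk
  have hs : ∑ i ∈ A, c i * f (u i) = 0 := by
    have := congrArg f hc
    simpa [map_sum] using this
  rw [← hs]
  refine Finset.sum_lt_sum (fun i hi => ?_) ⟨l, hl, ?_⟩
  · by_cases hij : i = j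
    · simp [hij, hfj]
    by_cases hik : i = k
    · simp [hik, hfk]
    nlinarith [hneg i hi hij hik, hf i hij hik]
  · nlinarith [hf l hlj hlk]

lemma coeff_eq_zero_of_card_le (h : NeighborlyCone u ℓ) {A : Finset J} (hA : A.card ≤ 4)
    {c : J → ℝ} (hc : ∑ j ∈ A, c j • u j = 0) : ∀ j ∈ A, c j = 0 := by
  classical
  have hc' : ∑ j ∈ A, (-c) j • u j = 0 := by simp [hc]
  have hcard : (A.filter fun j => 0 < c j).card + (A.filter fun j => 0 < (-c) j).card ≤ 4 := by
    rw [← Finset.card_union_of_disjoint]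
    · refine (Finset.card_le_card ?_).trans hA
      exact Finset.union_subset (Finset.filter_subset _ _) (Finset.filter_subset _ _)
    · rw [Finset.disjoint_filter]
      intro j _ h1 h2
      simp only [Pi.neg_apply] at h2
      linarith
  by_contra hne
  push Not at hne
  obtain ⟨j₀, hj₀, hcj₀⟩ := hne
  have two_le : ∀ c : J → ℝ, ∑ j ∈ A, c j • u j = 0 → c j₀ ≠ 0 →
      2 ≤ (A.filter fun j => 0 < c j).card := by
    intro c hc hcj
    by_contra hlt
    have hle : (A.filter fun j => 0 < c j).card ≤ 1 := by omega
    have : Nonempty J := ⟨j₀⟩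
    obtain ⟨j, hj⟩ := Finset.card_le_one_iff_subset_singleton.1 hle
    refine hcj (h.coeff_eq_zero hc j (fun k hk hkj => ?_) j₀ hj₀)
    by_contra hk0
    push Not at hk0
    exact hkj (Finset.mem_singleton.1 (hj (Finset.mem_filter.2 ⟨hk, hk0⟩)))
  have hp := two_le c hc hcj₀
  have hn := two_le (-c) hc' (by simpa using hcj₀)
  have sum_neg : ∀ c : J → ℝ, ∑ j ∈ A, c j • u j = 0 →
      (A.filter fun j => 0 < c j).card = 2 → 2 ≤ (A.filter fun j => 0 < (-c) j).card →
      ∑ j ∈ A, c j < 0 := by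
    intro c hc h2 hn
    obtain ⟨j, k, hjk, hpair⟩ := Finset.card_eq_two.1 h2
    obtain ⟨l, hl⟩ := Finset.card_pos.1 (by omega : 0 < (A.filter fun j => 0 < (-c) j).card)
    have hl' := Finset.mem_filter.1 hl
    have hlc : c l < 0 := by simpa using hl'.2
    have hpos : ∀ i, i = j ∨ i = k → 0 < c i := by
      intro i hi
      have : i ∈ A.filter fun j => 0 < c j := by rw [hpair]; simpa using hi
      exact (Finset.mem_filter.1 this).2
    refine h.sum_coeff_neg hc hjk (fun i hi hij hik => ?_) hl'.1 hlc ?_ ?_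
    · by_contra h0
      push Not at h0
      have : i ∈ A.filter fun j => 0 < c j := Finset.mem_filter.2 ⟨hi, h0⟩
      rw [hpair] at this
      simp [hij, hik] at this
    · rintro rfl
      linarith [hpos l (Or.inl rfl)]
    · rintro rfl
      linarith [hpos l (Or.inr rfl)]
  have hs := sum_neg c hc (by omega) hn
  have hs' := sum_neg (-c) hc' (by omega) (by simpa using hp)
  simp at hs'
  linarith

lemma card_le_finrank (h : NeighborlyCone u ℓ) [FiniteDimensional ℝ W] {A : Finset J}
    (hA : A.card ≤ 4) {S : Submodule ℝ W} (hS : ∀ j ∈ A, u j ∈ S) :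
    A.card ≤ Module.finrank ℝ S := by
  have hli : LinearIndependent ℝ (fun j : A => u j) :=
    (linearIndepOn_finset_iff (s := A) (v := u)).2 fun c hc => h.coeff_eq_zero_of_card_le hA hc
  have h1 := finrank_span_eq_card hli
  rw [Fintype.card_coe] at h1
  rw [← h1]
  apply Submodule.finrank_mono
  rw [Submodule.span_le]
  rintro _ ⟨j, rfl⟩
  exact hS j j.2

variable [Fintype I]

lemma finrank_coordSubspace_support_le (h : NeighborlyCone u ℓ) (j : J) :
    Module.finrank ℝ (coordSubspace ℓ (coordSupport ℓ (u j))) ≤ 1 := by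
  classical
  refine finrank_le_one ⟨u j, mem_coordSubspace_iff.2 subset_rfl⟩ ?_
  rintro ⟨y, hy⟩
  obtain ⟨M, -, hM⟩ := exists_abs_le_mul (fun i => ℓ i (u j)) (fun i => ℓ i y)
    (fun i => h.nonneg i j) fun i hi => hy i (by simpa [mem_coordSupport] using hi)
  obtain ⟨c, hc0, hc⟩ := h.mem_cone (M • u j + y) fun i => by
    simp only [map_add, map_smul, smul_eq_mul]
    linarith [neg_abs_le (ℓ i y), hM i]
  obtain ⟨c', hc0', hc'⟩ := h.mem_cone (M • u j - y) fun i => by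
    simp only [map_sub, map_smul, smul_eq_mul]
    linarith [le_abs_self (ℓ i y), hM i]
  have hsum : ∑ k, ((if k = j then 2 * M else 0) - (c k + c' k)) • u k = 0 := by
    simp only [sub_smul, add_smul, Finset.sum_sub_distrib, Finset.sum_add_distrib, ite_smul,
      zero_smul, Finset.sum_ite_eq', Finset.mem_univ, if_true, ← hc, ← hc']
    rw [two_mul, add_smul]
    abel
  have hz := h.coeff_eq_zero hsum j fun k _ hk => by
    simp only [hk, if_false]
    linarith [hc0 k, hc0' k]
  have hck : ∀ k, k ≠ j → c k = 0 := fun k hk => by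
    have := hz k (Finset.mem_univ k)
    simp only [hk, if_false] at this
    linarith [hc0 k, hc0' k]
  rw [Finset.sum_eq_single_of_mem j (Finset.mem_univ j) fun k _ hk => by simp [hck k hk]] at hc
  refine ⟨c j - M, Subtype.ext ?_⟩
  change (c j - M) • u j = y
  rw [sub_smul, ← hc]
  abel

lemma card_le_of_support_subset (h : NeighborlyCone u ℓ) [FiniteDimensional ℝ W] [DecidableEq I]
    {A : Finset J} (hA : A.card ≤ 4) (j : J) (B : Finset I)
    (hAB : ∀ k ∈ A, coordSupport ℓ (u k) ⊆ coordSupport ℓ (u j) ∪ B) :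
    A.card ≤ 1 + B.card := by
  have h1 := h.card_le_finrank hA fun k hk => mem_coordSubspace_iff.2 (hAB k hk)
  have h2 := finrank_coordSubspace_union_le (ℓ := ℓ) (coordSupport ℓ (u j)) B
  have h3 := h.finrank_coordSubspace_support_le j
  omega

lemma eq_of_support_subset (h : NeighborlyCone u ℓ) [FiniteDimensional ℝ W] {j k : J}
    (hjk : coordSupport ℓ (u j) ⊆ coordSupport ℓ (u k)) : j = k := by
  classical
  by_contra hne
  have := h.card_le_of_support_subset (A := {j, k}) (by rw [Finset.card_pair hne]; omega) k ∅
    (by simp [hjk])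
  rw [Finset.card_pair hne] at this
  simp at this

lemma exists_support_subset (h : NeighborlyCone u ℓ) {T : Finset I} {a : I} {y : W}
    (hy : ∀ i, 0 ≤ ℓ i y) (hyT : coordSupport ℓ y ⊆ T) (ha : 0 < ℓ a y) :
    ∃ j, a ∈ coordSupport ℓ (u j) ∧ coordSupport ℓ (u j) ⊆ T := by
  obtain ⟨c, hc0, rfl⟩ := h.mem_cone y hy
  simp only [map_sum, map_smul, smul_eq_mul] at ha
  obtain ⟨j, -, hj⟩ := Finset.exists_lt_of_sum_lt (f := fun _ : J => (0 : ℝ)) (by simpa using ha)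
  have hcj : c j ≠ 0 := by
    rintro h0
    simp [h0] at hj
  refine ⟨j, mem_coordSupport.2 fun h0 => by simp [h0] at hj, fun i hi => ?_⟩
  apply hyT
  rw [mem_coordSupport] at hi ⊢
  simp only [map_sum, map_smul, smul_eq_mul]
  intro h0
  have := (Finset.sum_eq_zero_iff_of_nonneg fun k _ => mul_nonneg (hc0 k) (h.nonneg i k)).1 h0 j
    (Finset.mem_univ j)
  exact (mul_ne_zero hcj hi) this

variable [FiniteDimensional ℝ W]

lemma card_support_le (h : NeighborlyCone u ℓ)
    (hI : Fintype.card I ≤ Module.finrank ℝ W + 2) (j : J) :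
    (coordSupport ℓ (u j)).card ≤ 3 := by
  classical
  have h1 := finrank_le_finrank_coordSubspace (ℓ := ℓ) (coordSupport ℓ (u j))
  have h2 := h.finrank_coordSubspace_support_le j
  omega

lemma exists_support_subset_insert (h : NeighborlyCone u ℓ) [DecidableEq I]
    (hI : Fintype.card I ≤ Module.finrank ℝ W + 2) {j : J}
    (hj : (coordSupport ℓ (u j)).card = 3) {a : I} (ha : a ∉ coordSupport ℓ (u j)) :
    ∃ k, a ∈ coordSupport ℓ (u k) ∧ coordSupport ℓ (u k) ⊆ insert a (coordSupport ℓ (u j)) := by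
  have h1 := finrank_le_finrank_coordSubspace (ℓ := ℓ) (insert a (coordSupport ℓ (u j)))
  rw [Finset.card_insert_of_notMem ha, hj] at h1
  have h2 := h.finrank_coordSubspace_support_le j
  obtain ⟨y, hyT, hya⟩ : ∃ y ∈ coordSubspace ℓ (insert a (coordSupport ℓ (u j))), 0 < ℓ a y := by
    by_contra hno
    push Not at hno
    have hle : coordSubspace ℓ (insert a (coordSupport ℓ (u j))) ≤
        coordSubspace ℓ (coordSupport ℓ (u j)) := by
      intro y hy i hi
      by_cases hia : i = a
      · subst hia
        have h3 := hno y hy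
        have h4 := hno (-y) (Submodule.neg_mem _ hy)
        rw [map_neg] at h4
        linarith
      · exact hy i (by simp [hia, hi])
    have := Submodule.finrank_mono hle
    omega
  obtain ⟨M, -, hM⟩ := exists_abs_le_mul (fun i => ℓ i (u j))
    (fun i => if ℓ i (u j) = 0 then 0 else ℓ i y)
    (fun i => h.nonneg i j) fun i hi => by simp [hi]
  have ha0 : ℓ a (u j) = 0 := by simpa [mem_coordSupport] using ha
  refine h.exists_support_subset (y := M • u j + y) (fun i => ?_) ?_ (by simpa [ha0] using hya)
  · simp only [map_add, map_smul, smul_eq_mul]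
    have hMi := hM i
    by_cases h0 : ℓ i (u j) = 0
    · by_cases hia : i = a
      · subst hia
        simp [h0, hya.le]
      · have : ℓ i y = 0 := hyT i (by simp [hia, mem_coordSupport, h0])
        simp [h0, this]
    · simp only [h0, if_false] at hMi
      linarith [neg_abs_le (ℓ i y)]
  · rw [← mem_coordSubspace_iff]
    exact Submodule.add_mem _
      (Submodule.smul_mem _ _ (mem_coordSubspace_iff.2 (Finset.subset_insert _ _))) hyT

lemma card_sdiff_support (h : NeighborlyCone u ℓ) [DecidableEq I]
    (hI : Fintype.card I ≤ Module.finrank ℝ W + 2) {j : J}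
    (hj : (coordSupport ℓ (u j)).card = 3) {k : J} (hkj : k ≠ j) :
    (coordSupport ℓ (u k) \ coordSupport ℓ (u j)).card = 1 ∨
      (coordSupport ℓ (u k) \ coordSupport ℓ (u j)).card = 3 := by
  classical
  have hk3 := h.card_support_le hI k
  have hle : (coordSupport ℓ (u k) \ coordSupport ℓ (u j)).card ≤ 3 :=
    (Finset.card_le_card Finset.sdiff_subset).trans hk3
  have h0 : (coordSupport ℓ (u k) \ coordSupport ℓ (u j)).card ≠ 0 := by
    intro h0
    rw [Finset.card_eq_zero, Finset.sdiff_eq_empty_iff_subset] at h0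
    exact hkj (h.eq_of_support_subset h0)
  have h2 : (coordSupport ℓ (u k) \ coordSupport ℓ (u j)).card ≠ 2 := by
    intro h2
    obtain ⟨a, b, hab, hS⟩ := Finset.card_eq_two.1 h2
    have haS : a ∈ coordSupport ℓ (u k) \ coordSupport ℓ (u j) := by rw [hS]; simp
    have hbS : b ∈ coordSupport ℓ (u k) \ coordSupport ℓ (u j) := by rw [hS]; simp
    rw [Finset.mem_sdiff] at haS hbS
    obtain ⟨p, hap, hp⟩ := h.exists_support_subset_insert hI hj haS.2
    obtain ⟨q, hbq, hq⟩ := h.exists_support_subset_insert hI hj hbS.2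
    have hbp : b ∉ coordSupport ℓ (u p) := fun hb => by
      simpa [hab.symm, hbS.2] using hp hb
    have haq : a ∉ coordSupport ℓ (u q) := fun ha => by
      simpa [hab, haS.2] using hq ha
    have hjp : j ≠ p := by rintro rfl; exact haS.2 hap
    have hjq : j ≠ q := by rintro rfl; exact hbS.2 hbq
    have hpq : p ≠ q := by rintro rfl; exact haq hap
    have hkp : k ≠ p := by rintro rfl; exact hbp hbS.1
    have hkq : k ≠ q := by rintro rfl; exact haq haS.1
    have hcard : ({j, k, p, q} : Finset J).card = 4 := by
      rw [Finset.card_insert_of_notMem (by simp [hkj.symm, hjp, hjq]),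
        Finset.card_insert_of_notMem (by simp [hkp, hkq]), Finset.card_pair hpq]
    have := h.card_le_of_support_subset hcard.le j {a, b} (by
      intro i hi
      simp only [Finset.mem_insert, Finset.mem_singleton] at hi
      rcases hi with rfl | rfl | rfl | rfl
      · exact Finset.subset_union_left
      · rw [← hS]
        simp
      · exact hp.trans (by intro x; simp; tauto)
      · exact hq.trans (by intro x; simp; tauto))
    rw [hcard, Finset.card_pair hab] at this
    omega
  omega

lemma eq_of_sdiff_eq_singleton (h : NeighborlyCone u ℓ) [DecidableEq I] {j k k' : J} {a : I}
    (hk : coordSupport ℓ (u k) \ coordSupport ℓ (u j) = {a})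
    (hk' : coordSupport ℓ (u k') \ coordSupport ℓ (u j) = {a}) : k = k' := by
  classical
  by_contra hne
  have hkj : j ≠ k := by rintro rfl; simp at hk
  have hkj' : j ≠ k' := by rintro rfl; simp at hk'
  have hcard : ({j, k, k'} : Finset J).card = 3 := by
    rw [Finset.card_insert_of_notMem (by simp [hkj, hkj']), Finset.card_pair hne]
  have := h.card_le_of_support_subset (A := {j, k, k'}) (by omega) j {a} (by
    intro i hi
    simp only [Finset.mem_insert, Finset.mem_singleton] at hi
    rcases hi with rfl | rfl | rfl
    · exact Finset.subset_union_left
    · rw [← hk]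
      simp
    · rw [← hk']
      simp)
  rw [hcard] at this
  simp at this

/-- Two disjoint three-element supports determine the supports of all other generators. -/
lemma eq_of_disjoint_supports (h : NeighborlyCone u ℓ) [DecidableEq I]
    (hI : Fintype.card I ≤ Module.finrank ℝ W + 2) {j k x : J}
    (hj : (coordSupport ℓ (u j)).card = 3) (hk : (coordSupport ℓ (u k)).card = 3)
    (hjk : Disjoint (coordSupport ℓ (u k)) (coordSupport ℓ (u j)))
    (hx : (coordSupport ℓ (u x)).card = 3)
    (hxj : Disjoint (coordSupport ℓ (u x)) (coordSupport ℓ (u j))) : x = k := by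
  by_contra hxk
  obtain ⟨a, hax, hak⟩ : ∃ a ∈ coordSupport ℓ (u x), a ∉ coordSupport ℓ (u k) := by
    by_contra hno
    push Not at hno
    exact hxk (h.eq_of_support_subset hno)
  have haj : a ∉ coordSupport ℓ (u j) := Finset.disjoint_left.1 hxj hax
  obtain ⟨p, hap, hp⟩ := h.exists_support_subset_insert hI hj haj
  obtain ⟨q, haq, hq⟩ := h.exists_support_subset_insert hI hk hak
  have key : ∀ {r : J}, coordSupport ℓ (u r) = {a} → False := by
    intro r hr
    have : r = x := h.eq_of_support_subset (by rw [hr]; simpa using hax)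
    subst this
    rw [hr] at hx
    simp at hx
  have hpk : coordSupport ℓ (u p) \ coordSupport ℓ (u k) = coordSupport ℓ (u p) := by
    rw [Finset.sdiff_eq_self_iff_disjoint, Finset.disjoint_left]
    intro i hi hik
    rcases Finset.mem_insert.1 (hp hi) with rfl | hij
    · exact hak hik
    · exact Finset.disjoint_left.1 hjk hik hij
  have hqj : coordSupport ℓ (u q) \ coordSupport ℓ (u j) = coordSupport ℓ (u q) := by
    rw [Finset.sdiff_eq_self_iff_disjoint, Finset.disjoint_left]
    intro i hi hij
    rcases Finset.mem_insert.1 (hq hi) with rfl | hik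
    · exact haj hij
    · exact Finset.disjoint_left.1 hjk hik hij
  have eq_single : ∀ {r : J}, a ∈ coordSupport ℓ (u r) → (coordSupport ℓ (u r)).card = 1 →
      coordSupport ℓ (u r) = {a} := by
    intro r har hr
    obtain ⟨b, hb⟩ := Finset.card_eq_one.1 hr
    rw [hb] at har ⊢
    rw [Finset.mem_singleton.1 har]
  have hp3 : (coordSupport ℓ (u p)).card = 3 := by
    have := h.card_sdiff_support hI hk (k := p) (by rintro rfl; exact hak hap)
    rw [hpk] at this
    exact this.resolve_left fun h1 => key (eq_single hap h1)
  have hq3 : (coordSupport ℓ (u q)).card = 3 := by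
    have := h.card_sdiff_support hI hj (k := q) (by rintro rfl; exact haj haq)
    rw [hqj] at this
    exact this.resolve_left fun h1 => key (eq_single haq h1)
  have hpq : coordSupport ℓ (u q) ∩ coordSupport ℓ (u p) = {a} := by
    ext i
    simp only [Finset.mem_inter, Finset.mem_singleton]
    constructor
    · rintro ⟨hiq, hip⟩
      by_contra hia
      exact Finset.disjoint_left.1 hjk ((Finset.mem_insert.1 (hq hiq)).resolve_left hia)
        ((Finset.mem_insert.1 (hp hip)).resolve_left hia)
    · rintro rfl
      exact ⟨haq, hap⟩
  have hcard := Finset.card_sdiff_add_card_inter (coordSupport ℓ (u q)) (coordSupport ℓ (u p))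
  rw [hpq, hq3, Finset.card_singleton] at hcard
  have hne : q ≠ p := by
    rintro rfl
    rw [Finset.inter_self] at hpq
    exact key hpq
  have := h.card_sdiff_support hI hp3 hne
  omega

lemma card_lt_of_card_support_eq_three (h : NeighborlyCone u ℓ)
    (hI : Fintype.card I ≤ Module.finrank ℝ W + 2) {j : J}
    (hj : (coordSupport ℓ (u j)).card = 3) : Fintype.card J < Fintype.card I := by
  classical
  let A : Finset J := Finset.univ.filter fun k =>
    (coordSupport ℓ (u k) \ coordSupport ℓ (u j)).card = 1
  let B : Finset J := Finset.univ.filter fun k =>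
    (coordSupport ℓ (u k) \ coordSupport ℓ (u j)).card = 3
  have hcover : (Finset.univ : Finset J) ⊆ insert j (A ∪ B) := by
    intro k _
    by_cases hkj : k = j
    · simp [hkj]
    · have := h.card_sdiff_support hI hj hkj
      simp [A, B, this]
  have hB : B.card ≤ 1 := by
    have hdisj : ∀ k ∈ B, (coordSupport ℓ (u k)).card = 3 ∧
        Disjoint (coordSupport ℓ (u k)) (coordSupport ℓ (u j)) := by
      intro k hk
      have hk3 : (coordSupport ℓ (u k) \ coordSupport ℓ (u j)).card = 3 := by
        simpa [B] using hk
      have heq := Finset.eq_of_subset_of_card_le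
        (Finset.sdiff_subset (s := coordSupport ℓ (u k)) (t := coordSupport ℓ (u j)))
        (by rw [hk3]; exact h.card_support_le hI k)
      exact ⟨heq ▸ hk3, Finset.sdiff_eq_self_iff_disjoint.1 heq⟩
    rw [Finset.card_le_one]
    intro x hx k hk
    exact h.eq_of_disjoint_supports hI hj (hdisj k hk).1 (hdisj k hk).2 (hdisj x hx).1
      (hdisj x hx).2
  have hA : A.card ≤ Fintype.card I - 3 := by
    rw [← hj, ← Finset.card_compl, ← Nat.choose_one_right (coordSupport ℓ (u j))ᶜ.card,
      ← Finset.card_powersetCard]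
    refine Finset.card_le_card_of_injOn
      (fun k => coordSupport ℓ (u k) \ coordSupport ℓ (u j)) (fun k hk => ?_) ?_
    · have hk1 : (coordSupport ℓ (u k) \ coordSupport ℓ (u j)).card = 1 := by simpa [A] using hk
      refine Finset.mem_coe.2 (Finset.mem_powersetCard.2 ⟨fun i hi => ?_, hk1⟩)
      simp only [Finset.mem_sdiff] at hi
      simp [hi.2]
    · intro k hk k' _ hkk'
      have hk1 : (coordSupport ℓ (u k) \ coordSupport ℓ (u j)).card = 1 := by simpa [A] using hk
      obtain ⟨a, ha⟩ := Finset.card_eq_one.1 hk1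
      exact h.eq_of_sdiff_eq_singleton ha (hkk'.symm.trans ha)
  have h3 : 3 ≤ Fintype.card I := hj ▸ Finset.card_le_univ _
  have h4 := Finset.card_le_card hcover
  have h5 := Finset.card_insert_le j (A ∪ B)
  have h6 := Finset.card_union_le A B
  rw [Finset.card_univ] at h4
  omega

lemma exists_private_coord (h : NeighborlyCone u ℓ)
    (hS : ∀ j, (coordSupport ℓ (u j)).card ≤ 2) (x : J) :
    ∃ i ∈ coordSupport ℓ (u x), ∀ y, y ≠ x → i ∉ coordSupport ℓ (u y) := by
  classical
  by_contra hno
  push Not at hno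
  have hne : (coordSupport ℓ (u x)).card ≠ 0 := by
    intro h0
    rw [Finset.card_eq_zero] at h0
    have hx := h.finrank_coordSubspace_support_le x
    obtain ⟨c, hc0, hc⟩ := h.mem_cone (-u x) fun i => by
      have : ℓ i (u x) = 0 := by
        by_contra hi
        have := mem_coordSupport.2 hi
        simp [h0] at this
      simp [this]
    have hs : ∑ k, (-c k - if k = x then 1 else 0) • u k = 0 := by
      simp [sub_smul, Finset.sum_sub_distrib, ← hc]
    have := h.coeff_eq_zero hs x (fun k _ hk => by simp [hk, hc0 k]) x (Finset.mem_univ x)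
    simp at this
    linarith [hc0 x]
  have hpair : ∀ {y i}, y ≠ x → i ∈ coordSupport ℓ (u x) → i ∈ coordSupport ℓ (u y) →
      ∃ i', i' ∉ coordSupport ℓ (u x) ∧ coordSupport ℓ (u y) = {i, i'} := by
    intro y i hyx hix hiy
    obtain ⟨i', hi', hi'x⟩ : ∃ i' ∈ coordSupport ℓ (u y), i' ∉ coordSupport ℓ (u x) := by
      by_contra hno
      push Not at hno
      exact hyx (h.eq_of_support_subset hno)
    refine ⟨i', hi'x, (Finset.eq_of_subset_of_card_le ?_ ?_).symm⟩
    · intro a ha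
      rcases Finset.mem_insert.1 ha with rfl | ha
      · exact hiy
      · rwa [Finset.mem_singleton.1 ha]
    · rw [Finset.card_pair (by rintro rfl; exact hi'x hix)]
      exact hS y
  have h2 := hS x
  have hcases : (coordSupport ℓ (u x)).card = 1 ∨ (coordSupport ℓ (u x)).card = 2 := by omega
  rcases hcases with h1 | h2
  · obtain ⟨i, hi⟩ := Finset.card_eq_one.1 h1
    obtain ⟨y, hyx, hy⟩ := hno i (by simp [hi])
    exact hyx (h.eq_of_support_subset (by simpa [hi] using hy)).symm
  · obtain ⟨i, k, hik, hx⟩ := Finset.card_eq_two.1 h2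
    have hix : i ∈ coordSupport ℓ (u x) := by simp [hx]
    have hkx : k ∈ coordSupport ℓ (u x) := by simp [hx]
    obtain ⟨y, hyx, hy⟩ := hno i hix
    obtain ⟨z, hzx, hz⟩ := hno k hkx
    obtain ⟨i', hi', hyS⟩ := hpair hyx hix hy
    obtain ⟨k', hk', hzS⟩ := hpair hzx hkx hz
    have hiz : i ∉ coordSupport ℓ (u z) := by
      rw [hzS]
      simp only [Finset.mem_insert, Finset.mem_singleton, not_or]
      exact ⟨hik, by rintro rfl; exact hk' hix⟩
    have hky : k ∉ coordSupport ℓ (u y) := by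
      rw [hyS]
      simp only [Finset.mem_insert, Finset.mem_singleton, not_or]
      exact ⟨hik.symm, by rintro rfl; exact hi' hkx⟩
    have pos : ∀ {a : I} {b : J}, a ∈ coordSupport ℓ (u b) → 0 < ℓ a (u b) := fun hab =>
      lt_of_le_of_ne (h.nonneg _ _) (mem_coordSupport.1 hab).symm
    have zer : ∀ {a : I} {b : J}, a ∉ coordSupport ℓ (u b) → ℓ a (u b) = 0 := fun hab => by
      simpa [mem_coordSupport] using hab
    have hi'y : i' ∈ coordSupport ℓ (u y) := by simp [hyS]
    have hα : 0 < ℓ i (u x) / ℓ i (u y) := div_pos (pos hix) (pos hy)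
    have hβ : 0 < ℓ k (u x) / ℓ k (u z) := div_pos (pos hkx) (pos hz)
    have hwi : ℓ i ((ℓ i (u x) / ℓ i (u y)) • u y + (ℓ k (u x) / ℓ k (u z)) • u z - u x) = 0 := by
      have := (pos hy).ne'
      simp only [map_sub, map_add, map_smul, smul_eq_mul, zer hiz]
      field_simp
      ring
    have hwk : ℓ k ((ℓ i (u x) / ℓ i (u y)) • u y + (ℓ k (u x) / ℓ k (u z)) • u z - u x) = 0 := by
      have := (pos hz).ne'
      simp only [map_sub, map_add, map_smul, smul_eq_mul, zer hky]
      field_simp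
      ring
    obtain ⟨q, hi'q, hq⟩ := h.exists_support_subset (T := {i', k'}) (a := i')
      (y := (ℓ i (u x) / ℓ i (u y)) • u y + (ℓ k (u x) / ℓ k (u z)) • u z - u x)
      (fun a => by
        by_cases ha : a ∈ coordSupport ℓ (u x)
        · rw [hx, Finset.mem_insert, Finset.mem_singleton] at ha
          rcases ha with rfl | rfl
          · exact hwi.ge
          · exact hwk.ge
        · simp only [map_sub, map_add, map_smul, smul_eq_mul, zer ha, sub_zero]
          exact add_nonneg (mul_nonneg hα.le (h.nonneg _ _)) (mul_nonneg hβ.le (h.nonneg _ _)))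
      (fun a ha => by
        have ha0 := mem_coordSupport.1 ha
        by_contra haT
        simp only [Finset.mem_insert, Finset.mem_singleton, not_or] at haT
        have hai : a ≠ i := by rintro rfl; exact ha0 hwi
        have hak : a ≠ k := by rintro rfl; exact ha0 hwk
        apply ha0
        have hax : a ∉ coordSupport ℓ (u x) := by simp [hx, hai, hak]
        have hay : a ∉ coordSupport ℓ (u y) := by simp [hyS, hai, haT.1]
        have haz : a ∉ coordSupport ℓ (u z) := by simp [hzS, hak, haT.2]
        simp [zer hax, zer hay, zer haz])
      (by
        simp only [map_sub, map_add, map_smul, smul_eq_mul, zer hi', sub_zero]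
        exact add_pos_of_pos_of_nonneg (mul_pos hα (pos hi'y))
          (mul_nonneg hβ.le (h.nonneg _ _)))
    have hiq : i ∉ coordSupport ℓ (u q) := fun hi => by
      rcases Finset.mem_insert.1 (hq hi) with rfl | hi
      · exact hi' hix
      · rw [Finset.mem_singleton.1 hi] at hix
        exact hk' hix
    have hkq : k ∉ coordSupport ℓ (u q) := fun hk => by
      rcases Finset.mem_insert.1 (hq hk) with rfl | hk
      · exact hi' hkx
      · rw [Finset.mem_singleton.1 hk] at hkx
        exact hk' hkx
    have hyz : y ≠ z := by rintro rfl; exact hiz hy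
    have hyq : y ≠ q := by rintro rfl; exact hiq hy
    have hzq : z ≠ q := by rintro rfl; exact hkq hz
    have hxq : x ≠ q := by rintro rfl; exact hiq hix
    have hcard : ({x, y, z, q} : Finset J).card = 4 := by
      rw [Finset.card_insert_of_notMem (by simp [hyx.symm, hzx.symm, hxq]),
        Finset.card_insert_of_notMem (by simp [hyz, hyq]), Finset.card_pair hzq]
    have := h.card_le_of_support_subset hcard.le x {i', k'} (by
      intro a ha
      simp only [Finset.mem_insert, Finset.mem_singleton] at ha
      rcases ha with rfl | rfl | rfl | rfl
      · exact Finset.subset_union_left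
      · rw [hyS, hx]
        intro b
        simp
        tauto
      · rw [hzS, hx]
        intro b
        simp
        tauto
      · exact hq.trans Finset.subset_union_right)
    have h3 := Finset.card_le_two (a := i') (b := k')
    omega

lemma card_le_finrank_of_card_support_le_two (h : NeighborlyCone u ℓ)
    (hS : ∀ j, (coordSupport ℓ (u j)).card ≤ 2) : Fintype.card J ≤ Module.finrank ℝ W := by
  refine LinearIndependent.fintype_card_le_finrank (b := u) ?_
  rw [Fintype.linearIndependent_iff]
  intro c hc x
  obtain ⟨i, hi, hiy⟩ := h.exists_private_coord hS x
  have hs : ∑ y, c y * ℓ i (u y) = 0 := by simpa [map_sum] using congrArg (ℓ i) hc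
  rw [Finset.sum_eq_single_of_mem x (Finset.mem_univ x) fun y _ hy => by
    have : ℓ i (u y) = 0 := by simpa [mem_coordSupport] using hiy y hy
    simp [this]] at hs
  exact (mul_eq_zero.1 hs).resolve_right (mem_coordSupport.1 hi)

/-- A neighborly cone of dimension `d` with at least `d + 2` generating rays is not cut out by
`d + 2` inequalities. -/
theorem finrank_add_two_lt_card (h : NeighborlyCone u ℓ)
    (hJ : Module.finrank ℝ W + 2 ≤ Fintype.card J) :
    Module.finrank ℝ W + 2 < Fintype.card I := by
  by_contra hI
  push Not at hI
  by_cases h3 : ∃ j, (coordSupport ℓ (u j)).card = 3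
  · obtain ⟨j, hj⟩ := h3
    have := h.card_lt_of_card_support_eq_three hI hj
    omega
  · push Not at h3
    have := h.card_le_finrank_of_card_support_le_two fun j => by
      have := h.card_support_le hI j
      have := h3 j
      omega
    omega

end NeighborlyCone

section FacetFunctionals

variable {W J : Type*} [NormedAddCommGroup W] [NormedSpace ℝ W] [Fintype J] {u : J → W}

lemma exists_nonneg_functional_neg (φ : W →ₗ[ℝ] ℝ) (hφ : ∀ j, 0 < φ (u j)) {y : W}
    (hy : ¬ ∃ c : J → ℝ, (∀ j, 0 ≤ c j) ∧ y = ∑ j, c j • u j) :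
    ∃ ℓ : W →ₗ[ℝ] ℝ, (∀ j, 0 ≤ ℓ (u j)) ∧ ℓ y < 0 := by
  classical
  have hy0 : y ≠ 0 := by
    rintro rfl
    exact hy ⟨0, by simp, by simp⟩
  have hpos : convexHull ℝ (range u) ⊆ {x | 0 < φ x} :=
    convexHull_min (by rintro _ ⟨j, rfl⟩; exact hφ j) (convex_halfSpace_gt φ.isLinear 0)
  have hcone : convexHull ℝ (range u) ⊆
      {x | ∃ c : J → ℝ, (∀ j, 0 ≤ c j) ∧ x = ∑ j, c j • u j} := by
    refine convexHull_min ?_ ?_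
    · rintro _ ⟨j, rfl⟩
      refine ⟨Pi.single j 1, fun k => ?_, ?_⟩
      · by_cases hk : k = j <;> simp [hk]
      · simp [Pi.single_apply]
    · rintro _ ⟨c, hc, rfl⟩ _ ⟨c', hc', rfl⟩ a b ha hb -
      refine ⟨fun j => a * c j + b * c' j, fun j => ?_, ?_⟩
      · have := mul_nonneg ha (hc j)
        have := mul_nonneg hb (hc' j)
        linarith
      · simp [add_smul, mul_smul, Finset.sum_add_distrib, Finset.smul_sum]
  have hdisj : Disjoint (convexHull ℝ (range u)) ((fun t : ℝ => t • y) '' Ici 0) := by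
    rw [Set.disjoint_left]
    rintro _ hx ⟨t, ht, rfl⟩
    have htpos : 0 < t := by
      refine lt_of_le_of_ne ht ?_
      rintro rfl
      have := hpos hx
      simp at this
    obtain ⟨c, hc, hcy⟩ := hcone hx
    refine hy ⟨fun j => t⁻¹ * c j, fun j => mul_nonneg (inv_nonneg.2 htpos.le) (hc j), ?_⟩
    simp only [mul_smul, ← Finset.smul_sum, ← hcy]
    rw [smul_smul, inv_mul_cancel₀ htpos.ne', one_smul]
  have hclosed : IsClosed ((fun t : ℝ => t • y) '' Ici 0) :=
    (isClosedEmbedding_smul_left hy0).isClosedMap _ isClosed_Ici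
  have hconv : Convex ℝ ((fun t : ℝ => t • y) '' Ici 0) :=
    (convex_Ici (0 : ℝ)).linear_image (LinearMap.toSpanSingleton ℝ W y)
  obtain ⟨f, a, b, hfa, hab, hfb⟩ := geometric_hahn_banach_compact_closed (convex_convexHull ℝ _)
    ((finite_range u).isCompact_convexHull ℝ) hconv hclosed hdisj
  have hb0 : b < 0 := by simpa using hfb _ ⟨0, self_mem_Ici, rfl⟩
  have hfu : ∀ j, 0 < -f (u j) := fun j => by
    linarith [hfa _ (subset_convexHull ℝ _ (mem_range_self j))]
  have hfy : 0 ≤ f y := by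
    by_contra hneg
    push Not at hneg
    have h1 := hfb _ ⟨b / f y, (div_pos_of_neg_of_neg hb0 hneg).le, rfl⟩
    simp only [map_smul, smul_eq_mul] at h1
    rw [div_mul_cancel₀ _ hneg.ne] at h1
    exact lt_irrefl _ h1
  obtain ⟨h, hh⟩ := geometric_hahn_banach_point_point hy0.symm
  rw [map_zero] at hh
  obtain ⟨M, hM0, hM⟩ := exists_abs_le_mul (fun j => -f (u j)) (fun j => h (u j))
    (fun j => (hfu j).le) fun j hj => absurd hj (hfu j).ne'
  refine ⟨(-M) • (f : W →ₗ[ℝ] ℝ) - (h : W →ₗ[ℝ] ℝ), fun j => ?_, ?_⟩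
  · simp only [LinearMap.sub_apply, LinearMap.smul_apply, ContinuousLinearMap.coe_coe, smul_eq_mul]
    have := hM j
    linarith [le_abs_self (h (u j))]
  · simp only [LinearMap.sub_apply, LinearMap.smul_apply, ContinuousLinearMap.coe_coe, smul_eq_mul]
    nlinarith

variable [FiniteDimensional ℝ W]

lemma exists_more_tight_functional (hspan : Submodule.span ℝ (range u) = ⊤) {y : W}
    {ℓ : W →ₗ[ℝ] ℝ} (hℓ : ∀ j, 0 ≤ ℓ (u j)) (hℓy : ℓ y < 0)
    (hlt : Module.finrank ℝ (Submodule.span ℝ (u '' {j | ℓ (u j) = 0})) + 1 <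
      Module.finrank ℝ W) :
    ∃ ℓ' : W →ₗ[ℝ] ℝ, (∀ j, 0 ≤ ℓ' (u j)) ∧ ℓ' y < 0 ∧
      Module.finrank ℝ (Submodule.span ℝ (u '' {j | ℓ (u j) = 0})) <
        Module.finrank ℝ (Submodule.span ℝ (u '' {j | ℓ' (u j) = 0})) := by
  obtain ⟨h, hZ, hy, hneg⟩ : ∃ h : W →ₗ[ℝ] ℝ,
      Submodule.span ℝ (u '' {j | ℓ (u j) = 0}) ≤ LinearMap.ker h ∧ h y = 0 ∧
        ∃ j, h (u j) < 0 := by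
    have hne : Submodule.span ℝ (u '' {j | ℓ (u j) = 0}) ⊔ Submodule.span ℝ {y} < ⊤ := by
      rw [lt_top_iff_ne_top]
      intro htop
      have h1 := Submodule.finrank_add_le_finrank_add_finrank
        (Submodule.span ℝ (u '' {j | ℓ (u j) = 0})) (Submodule.span ℝ {y})
      rw [htop, finrank_top] at h1
      have h2 : Module.finrank ℝ (Submodule.span ℝ {y}) ≤ 1 := by
        simpa using finrank_span_le_card (R := ℝ) ({y} : Set W)
      omega
    obtain ⟨h, hne0, hle⟩ := Submodule.exists_le_ker_of_lt_top _ hne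
    have hZ := le_sup_left.trans hle
    have hy : h y = 0 := (le_sup_right.trans hle : Submodule.span ℝ {y} ≤ LinearMap.ker h)
      (Submodule.mem_span_singleton_self y)
    obtain ⟨j, hj⟩ : ∃ j, h (u j) ≠ 0 := by
      by_contra hall
      push Not at hall
      exact hne0 (LinearMap.ext_on_range hspan (by simpa using hall))
    rcases lt_or_gt_of_ne hj with hj | hj
    · exact ⟨h, hZ, hy, j, hj⟩
    · refine ⟨-h, fun x hx => ?_, by simp [hy], j, by simpa using hj⟩
      have := hZ hx
      simpa using this
  obtain ⟨j₀, hj₀, hmin⟩ := Finset.exists_min_image (Finset.univ.filter fun j => h (u j) < 0)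
    (fun j => ℓ (u j) / (-h (u j))) (by obtain ⟨j, hj⟩ := hneg; exact ⟨j, by simpa using hj⟩)
  have hj₀' : h (u j₀) < 0 := by simpa using hj₀
  set t := ℓ (u j₀) / (-h (u j₀)) with ht
  have ht0 : 0 ≤ t := div_nonneg (hℓ j₀) (by linarith)
  refine ⟨ℓ + t • h, fun j => ?_, by simpa [hy] using hℓy, Submodule.finrank_lt_finrank_of_lt ?_⟩
  · simp only [LinearMap.add_apply, LinearMap.smul_apply, smul_eq_mul]
    by_cases hj : h (u j) < 0
    · have := hmin j (by simpa using hj)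
      rw [le_div_iff₀ (by linarith)] at this
      linarith
    · push Not at hj
      exact add_nonneg (hℓ j) (mul_nonneg ht0 hj)
  · have hmem : u j₀ ∈ Submodule.span ℝ (u '' {j | (ℓ + t • h) (u j) = 0}) := by
      refine Submodule.subset_span ⟨j₀, ?_, rfl⟩
      have hne := hj₀'.ne
      change ℓ (u j₀) + t * h (u j₀) = 0
      rw [ht]
      field_simp
      ring
    refine lt_of_le_of_ne (Submodule.span_mono (image_mono fun j hj => ?_)) fun heq => ?_
    · have hhj : h (u j) = 0 := hZ (Submodule.subset_span ⟨j, hj, rfl⟩)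
      simpa [hhj] using hj
    · rw [← heq] at hmem
      exact hj₀'.ne (hZ hmem)

/-- A vector outside a full-dimensional pointed finitely generated cone is separated from it by a
facet-defining functional. -/
lemma exists_facet_functional (hspan : Submodule.span ℝ (range u) = ⊤) (φ : W →ₗ[ℝ] ℝ)
    (hφ : ∀ j, 0 < φ (u j)) {y : W}
    (hy : ¬ ∃ c : J → ℝ, (∀ j, 0 ≤ c j) ∧ y = ∑ j, c j • u j) :
    ∃ ℓ : W →ₗ[ℝ] ℝ, (∀ j, 0 ≤ ℓ (u j)) ∧ ℓ y < 0 ∧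
      Module.finrank ℝ W ≤ Module.finrank ℝ (Submodule.span ℝ (u '' {j | ℓ (u j) = 0})) + 1 := by
  obtain ⟨ℓ, hℓ, hℓy⟩ := exists_nonneg_functional_neg φ hφ hy
  have improve : ∀ (n : ℕ) (ℓ : W →ₗ[ℝ] ℝ), (∀ j, 0 ≤ ℓ (u j)) → ℓ y < 0 →
      Module.finrank ℝ W ≤
        Module.finrank ℝ (Submodule.span ℝ (u '' {j | ℓ (u j) = 0})) + 1 + n →
      ∃ ℓ : W →ₗ[ℝ] ℝ, (∀ j, 0 ≤ ℓ (u j)) ∧ ℓ y < 0 ∧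
        Module.finrank ℝ W ≤
          Module.finrank ℝ (Submodule.span ℝ (u '' {j | ℓ (u j) = 0})) + 1 := by
    intro n
    induction n with
    | zero => exact fun ℓ hℓ hℓy hn => ⟨ℓ, hℓ, hℓy, hn⟩
    | succ n ih =>
      intro ℓ hℓ hℓy hn
      by_cases hle : Module.finrank ℝ W ≤
          Module.finrank ℝ (Submodule.span ℝ (u '' {j | ℓ (u j) = 0})) + 1
      · exact ⟨ℓ, hℓ, hℓy, hle⟩
      · push Not at hle
        obtain ⟨ℓ', hℓ', hℓy', hlt⟩ := exists_more_tight_functional hspan hℓ hℓy hle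
        exact ih ℓ' hℓ' hℓy' (by omega)
  exact improve (Module.finrank ℝ W) ℓ hℓ hℓy (by omega)

end FacetFunctionals

section Polytopes

lemma IsExposed.exists_functional {E : Type*} [AddCommGroup E] [TopologicalSpace E] [Module ℝ E]
    {A B : Set E} (h : IsExposed ℝ A B) (hB : B.Nonempty) :
    ∃ l : StrongDual ℝ E, (∀ b ∈ B, ∀ x ∈ A, l x ≤ l b) ∧ ∀ b ∈ B, ∀ x ∈ A, x ∉ B → l x < l b := by
  obtain ⟨l, hl⟩ := h hB
  have hmax : ∀ b ∈ B, ∀ x ∈ A, l x ≤ l b := fun b hb => by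
    rw [hl] at hb
    exact hb.2
  refine ⟨l, hmax, fun b hb x hx hxB => lt_of_le_of_ne (hmax b hb x hx) fun heq => hxB ?_⟩
  rw [hl]
  exact ⟨hx, fun z hz => heq ▸ hmax b hb z hz⟩

variable {N : ℕ} {P : Set (Fin N → ℝ)}

lemma IsPolytope.isCompact (hP : IsPolytope P) : IsCompact P := by
  obtain ⟨S, rfl⟩ := hP
  exact S.finite_toSet.isCompact_convexHull ℝ

lemma IsPolytope.convex (hP : IsPolytope P) : Convex ℝ P := by
  obtain ⟨S, rfl⟩ := hP
  exact convex_convexHull ℝ _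

lemma IsPolytope.finite_extremePoints (hP : IsPolytope P) : (P.extremePoints ℝ).Finite := by
  obtain ⟨S, rfl⟩ := hP
  exact S.finite_toSet.subset extremePoints_convexHull_subset

lemma IsPolytope.convexHull_extremePoints (hP : IsPolytope P) :
    convexHull ℝ (P.extremePoints ℝ) = P := by
  rw [← (hP.finite_extremePoints.isClosed_convexHull ℝ).closure_eq]
  exact closure_convexHull_extremePoints hP.isCompact hP.convex

lemma IsPolytope.vertexSet_eq (hP : IsPolytope P) : vertexSet P = P.extremePoints ℝ := by
  ext v
  constructor
  · intro hv
    exact exposedPoints_subset_extremePoints (mem_exposedPoints_iff_exposed_singleton.2 hv)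
  · intro hv
    refine mem_exposedPoints_iff_exposed_singleton.1 ⟨hv.1, ?_⟩
    have hnot : v ∉ convexHull ℝ (P.extremePoints ℝ \ {v}) := fun hmem =>
      (hP.convex.mem_extremePoints_iff_mem_sdiff_convexHull_sdiff.1 hv).2
        (convexHull_mono (sdiff_subset_sdiff_left extremePoints_subset) hmem)
    have hfin : (P.extremePoints ℝ \ {v}).Finite := hP.finite_extremePoints.subset sdiff_subset
    obtain ⟨l, a, hl, hav⟩ := geometric_hahn_banach_closed_point (convex_convexHull ℝ _)
      (hfin.isClosed_convexHull ℝ) hnot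
    have hle : P ⊆ {x | l x < l v ∨ x = v} := by
      rw [← hP.convexHull_extremePoints]
      refine convexHull_min (fun w hw => ?_) (convex_iff_pairwise_pos.2 ?_)
      · by_cases hwv : w = v
        · exact Or.inr hwv
        · exact Or.inl ((hl w (subset_convexHull ℝ _ ⟨hw, hwv⟩)).trans hav)
      · intro x hx y hy hxy s t hs ht hst
        have hx' : l x ≤ l v := hx.elim le_of_lt fun h => h ▸ le_rfl
        have hy' : l y ≤ l v := hy.elim le_of_lt fun h => h ▸ le_rfl
        left
        have hlv : l v = s * l v + t * l v := by rw [← add_mul, hst, one_mul]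
        rw [map_add, map_smul, map_smul, smul_eq_mul, smul_eq_mul, hlv]
        rcases hx with hx | rfl
        · exact add_lt_add_of_lt_of_le (mul_lt_mul_of_pos_left hx hs)
            (mul_le_mul_of_nonneg_left hy' ht.le)
        · rcases hy with hy | rfl
          · exact add_lt_add_of_le_of_lt le_rfl (mul_lt_mul_of_pos_left hy ht)
          · exact absurd rfl hxy
    refine ⟨l, fun x hx => ?_⟩
    rcases hle hx with hlt | rfl
    · exact ⟨hlt.le, fun h => absurd hlt h.not_gt⟩
    · exact ⟨le_rfl, fun _ => rfl⟩

lemma IsPolytope.finite_isExposed (hP : IsPolytope P) : {F | IsExposed ℝ P F}.Finite := by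
  refine Finite.of_injOn (f := fun F => F ∩ P.extremePoints ℝ)
    (fun F _ => inter_subset_right) (fun F hF G hG hFG => ?_) hP.finite_extremePoints.finite_subsets
  have key : ∀ F, IsExposed ℝ P F → F = closure (convexHull ℝ (F ∩ P.extremePoints ℝ)) := by
    intro F hF
    rw [← hF.isExtreme.extremePoints_eq]
    exact (closure_convexHull_extremePoints (hF.isCompact hP.isCompact)
      (hF.convex hP.convex)).symm
  rw [key F hF, key G hG]
  exact congrArg (fun S => closure (convexHull ℝ S)) hFG

lemma IsVertex.mem {v : Fin N → ℝ} (hv : IsVertex P v) : v ∈ P :=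
  IsExposed.subset hv (mem_singleton v)

lemma IsVertex.eq_or_eq_of_mem_convexHull_pair {w a b : Fin N → ℝ} (hw : IsVertex P w)
    (ha : a ∈ P) (hb : b ∈ P) (hwab : w ∈ convexHull ℝ {a, b}) : w = a ∨ w = b := by
  by_contra! hne
  have hext : w ∈ P.extremePoints ℝ :=
    exposedPoints_subset_extremePoints (mem_exposedPoints_iff_exposed_singleton.2 hw)
  rw [convexHull_pair] at hwab
  exact hne.1 (hext.2 ha hb (mem_openSegment_of_ne_left_right hne.1.symm hne.2.symm hwab)).symm

lemma IsPolytope.subset_of_vertexSet_subset (hP : IsPolytope P) {C : Set (Fin N → ℝ)}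
    (hC : Convex ℝ C) (h : vertexSet P ⊆ C) : P ⊆ C := by
  rw [← hP.convexHull_extremePoints, ← hP.vertexSet_eq]
  exact convexHull_min h hC

/-- The vector from the vertex `v` to another vertex, in the direction space of `P`. -/
def vertexDirection {v : Fin N → ℝ} (hv : IsVertex P v) (w : {w // IsVertex P w ∧ w ≠ v}) :
    vectorSpan ℝ P :=
  ⟨w.1 - v, vsub_mem_vectorSpan ℝ w.2.1.mem hv.mem⟩

section VertexDirection

variable {v : Fin N → ℝ} (hv : IsVertex P v)

lemma IsPolytope.span_range_vertexDirection (hP : IsPolytope P) :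
    Submodule.span ℝ (range (vertexDirection hv)) = ⊤ := by
  apply Submodule.map_injective_of_injective (vectorSpan ℝ P).injective_subtype
  rw [Submodule.map_top, Submodule.range_subtype, Submodule.map_span]
  have hvec : vectorSpan ℝ P = vectorSpan ℝ (vertexSet P) := by
    rw [← direction_affineSpan, ← direction_affineSpan, ← affineSpan_convexHull (vertexSet P),
      hP.vertexSet_eq, hP.convexHull_extremePoints]
  conv_rhs => rw [hvec]
  rw [vectorSpan_eq_span_vsub_set_right_ne ℝ (show v ∈ vertexSet P from hv)]
  congr 1
  ext x
  constructor
  · rintro ⟨_, ⟨w, rfl⟩, rfl⟩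
    exact ⟨w.1, ⟨w.2.1, w.2.2⟩, rfl⟩
  · rintro ⟨w, ⟨hw, hwv⟩, rfl⟩
    exact ⟨_, ⟨⟨w, hw, hwv⟩, rfl⟩, rfl⟩

lemma IsExposed.exists_functional_vertexDirection {F : Set (Fin N → ℝ)} (hF : IsExposed ℝ P F)
    (hvF : v ∈ F) :
    ∃ ℓ : vectorSpan ℝ P →ₗ[ℝ] ℝ, ∀ w, 0 ≤ ℓ (vertexDirection hv w) ∧
      (ℓ (vertexDirection hv w) = 0 ↔ w.1 ∈ F) := by
  obtain ⟨l, hl, hlt⟩ := hF.exists_functional ⟨v, hvF⟩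
  refine ⟨-((l : (Fin N → ℝ) →ₗ[ℝ] ℝ) ∘ₗ (vectorSpan ℝ P).subtype), fun w => ?_⟩
  have hval : (-((l : (Fin N → ℝ) →ₗ[ℝ] ℝ) ∘ₗ (vectorSpan ℝ P).subtype)) (vertexDirection hv w) =
      l v - l w.1 := by
    simp [vertexDirection]
  rw [hval, sub_nonneg, sub_eq_zero]
  refine ⟨hl v hvF w.1 w.2.1.mem, fun heq => ?_, fun hw => ?_⟩
  · by_contra hw
    exact (hlt v hvF w.1 w.2.1.mem hw).ne' heq
  · exact le_antisymm (hl w.1 hw v hv.mem) (hl v hvF w.1 w.2.1.mem)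

variable [Fintype {w // IsVertex P w ∧ w ≠ v}]

/-- A vector outside the cone of `P` at `v` violates the inequality of some facet through `v`. -/
lemma IsPolytope.exists_facet_of_notMem_cone (hP : IsPolytope P) {y : vectorSpan ℝ P}
    (hy : ¬ ∃ c : {w // IsVertex P w ∧ w ≠ v} → ℝ, (∀ w, 0 ≤ c w) ∧
      y = ∑ w, c w • vertexDirection hv w) :
    ∃ F, IsFacetOf P F ∧ v ∈ F ∧ ∀ ℓ' : vectorSpan ℝ P →ₗ[ℝ] ℝ,
      (∀ w, 0 ≤ ℓ' (vertexDirection hv w) ∧ (ℓ' (vertexDirection hv w) = 0 ↔ w.1 ∈ F)) →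
        ℓ' y < 0 := by
  have hspan := hP.span_range_vertexDirection hv
  obtain ⟨φ, hφ⟩ := IsExposed.exists_functional_vertexDirection hv hv (mem_singleton v)
  obtain ⟨ℓ, hℓ, hℓy, hrank⟩ := exists_facet_functional hspan φ
    (fun w => lt_of_le_of_ne (hφ w).1 fun h => w.2.2 ((hφ w).2.1 h.symm)) hy
  have hℓ0 : ℓ ≠ 0 := by
    rintro rfl
    simp at hℓy
  obtain ⟨L, hL⟩ := LinearMap.exists_extend ℓ
  have hLsub : ∀ x : vectorSpan ℝ P, L x = ℓ x := fun x => by rw [← hL]; rfl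
  have hLw : ∀ w, L w.1 = L v + ℓ (vertexDirection hv w) := fun w => by
    rw [← hLsub, vertexDirection, map_sub]
    ring
  have hLP : ∀ x ∈ P, L v ≤ L x := by
    refine hP.subset_of_vertexSet_subset (convex_halfSpace_ge L.isLinear (L v)) fun w hw => ?_
    by_cases hwv : w = v
    · rw [hwv]
      exact le_refl (L v)
    · have := hLw ⟨w, hw, hwv⟩
      have := hℓ ⟨w, hw, hwv⟩
      change L v ≤ L w
      linarith
  set F : Set (Fin N → ℝ) := {x ∈ P | L x = L v} with hF
  have hFexp : IsExposed ℝ P F := by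
    intro _
    refine ⟨-L.toContinuousLinearMap, ?_⟩
    ext x
    refine and_congr_right fun hx => ⟨fun h z hz => ?_, fun h => ?_⟩
    · have := hLP z hz
      simp only [neg_apply, LinearMap.coe_toContinuousLinearMap']
      linarith
    · have h1 := h v hv.mem
      simp only [neg_apply, LinearMap.coe_toContinuousLinearMap'] at h1
      exact le_antisymm (by linarith) (hLP x hx)
  have hvF : v ∈ F := ⟨hv.mem, rfl⟩
  have hwF : ∀ w, ℓ (vertexDirection hv w) = 0 → w.1 ∈ F := fun w hw =>
    ⟨w.2.1.mem, by rw [hLw, hw, add_zero]⟩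
  have hker : Submodule.span ℝ (vertexDirection hv '' {w | ℓ (vertexDirection hv w) = 0}) =
      LinearMap.ker ℓ := by
    refine Submodule.eq_of_le_of_finrank_le (Submodule.span_le.2 ?_) ?_
    · rintro _ ⟨w, hw, rfl⟩
      exact hw
    · have := Module.Dual.finrank_ker_add_one_of_ne_zero (f := ℓ) hℓ0
      omega
  have hdir : vectorSpan ℝ F = (LinearMap.ker ℓ).map (vectorSpan ℝ P).subtype := by
    apply le_antisymm
    · refine Submodule.span_le.2 ?_
      rintro _ ⟨a, ha, b, hb, rfl⟩
      refine ⟨⟨a -ᵥ b, vsub_mem_vectorSpan ℝ ha.1 hb.1⟩, ?_, rfl⟩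
      change ℓ _ = 0
      rw [← hLsub]
      change L (a - b) = 0
      rw [map_sub, ha.2, hb.2, sub_self]
    · rw [← hker, Submodule.map_span]
      refine Submodule.span_le.2 ?_
      rintro _ ⟨_, ⟨w, hw, rfl⟩, rfl⟩
      exact vsub_mem_vectorSpan ℝ (hwF w hw) hvF
  refine ⟨F, ⟨hFexp, ⟨v, hvF⟩, ?_⟩, hvF, fun ℓ' hℓ' => ?_⟩
  · rw [pdim, pdim, direction_affineSpan, direction_affineSpan, hdir,
      Submodule.finrank_map_subtype_eq]
    exact Module.Dual.finrank_ker_add_one_of_ne_zero hℓ0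
  · have hkerle : LinearMap.ker ℓ ≤ LinearMap.ker ℓ' := by
      rw [← hker]
      refine Submodule.span_le.2 ?_
      rintro _ ⟨w, hw, rfl⟩
      exact (hℓ' w).2.2 (hwF w hw)
    obtain ⟨w, hw⟩ : ∃ w, ℓ (vertexDirection hv w) ≠ 0 := by
      by_contra! hall
      exact hℓ0 (LinearMap.ext_on_range hspan (by simpa using hall))
    have hpos : 0 < ℓ (vertexDirection hv w) := lt_of_le_of_ne (hℓ w) hw.symm
    have hpos' : 0 < ℓ' (vertexDirection hv w) := by
      refine lt_of_le_of_ne (hℓ' w).1 fun h => hw ?_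
      have hmem := ((hℓ' w).2.1 h.symm).2
      rw [hLw] at hmem
      linarith
    have hz : y - (ℓ y / ℓ (vertexDirection hv w)) • vertexDirection hv w ∈ LinearMap.ker ℓ := by
      rw [LinearMap.mem_ker, map_sub, map_smul, smul_eq_mul, div_mul_cancel₀ _ hw, sub_self]
    have hz' := hkerle hz
    rw [LinearMap.mem_ker, map_sub, map_smul, smul_eq_mul, sub_eq_zero] at hz'
    rw [hz']
    exact mul_neg_of_neg_of_pos (div_neg_of_neg_of_pos hℓy hpos) hpos'

lemma TwoNeighborly.neighborlyCone (hP : IsPolytope P) (hnb : TwoNeighborly P)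
    {ℓ : {F // IsFacetOf P F ∧ v ∈ F} → vectorSpan ℝ P →ₗ[ℝ] ℝ}
    (hℓ : ∀ F w, 0 ≤ ℓ F (vertexDirection hv w) ∧ (ℓ F (vertexDirection hv w) = 0 ↔ w.1 ∈ F.1)) :
    NeighborlyCone (vertexDirection hv) ℓ where
  ne_zero w h := w.2.2 (sub_eq_zero.1 (congrArg Subtype.val h))
  nonneg F w := (hℓ F w).1
  mem_cone y hy := by
    by_contra hnot
    obtain ⟨F, hF, hvF, hlt⟩ := hP.exists_facet_of_notMem_cone hv hnot
    exact (hlt (ℓ ⟨F, hF, hvF⟩) (hℓ ⟨F, hF, hvF⟩)).not_ge (hy _)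
  exposed_ray w := by
    have hedge := (hnb v w.1 hv w.2.1 w.2.2.symm).1
    obtain ⟨g, hg⟩ := hedge.exists_functional_vertexDirection hv
      (subset_convexHull ℝ _ (mem_insert v _))
    refine ⟨-g, ?_, fun k hk => ?_⟩
    · rw [LinearMap.neg_apply, neg_eq_zero, (hg w).2]
      exact subset_convexHull ℝ _ (mem_insert_of_mem _ rfl)
    · rw [LinearMap.neg_apply, neg_lt_zero]
      refine lt_of_le_of_ne (hg k).1 fun h => ?_
      rcases k.2.1.eq_or_eq_of_mem_convexHull_pair hv.mem w.2.1.mem ((hg k).2.1 h.symm) with h | h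
      · exact k.2.2 h
      · exact hk (Subtype.ext h)
  exposed_edge j k hjk := by
    have hne : j.1 ≠ k.1 := fun h => hjk (Subtype.ext h)
    obtain ⟨l, hl, hlt⟩ := (hnb j.1 k.1 j.2.1 k.2.1 hne).1.exists_functional
      ⟨j.1, subset_convexHull ℝ _ (mem_insert _ _)⟩
    have hj : j.1 ∈ convexHull ℝ {j.1, k.1} := subset_convexHull ℝ _ (mem_insert _ _)
    have hk : k.1 ∈ convexHull ℝ {j.1, k.1} := subset_convexHull ℝ _ (mem_insert_of_mem _ rfl)
    have hjk : l k.1 = l j.1 := le_antisymm (hl _ hj _ k.2.1.mem) (hl _ hk _ j.2.1.mem)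
    have hout : ∀ x, IsVertex P x → x ≠ j.1 → x ≠ k.1 → l x < l j.1 := fun x hx hxj hxk =>
      hlt _ hj _ hx.mem fun h =>
        (hx.eq_or_eq_of_mem_convexHull_pair j.2.1.mem k.2.1.mem h).elim hxj hxk
    have hpos : 0 < l j.1 - l v := sub_pos.2 (hout v hv j.2.2.symm k.2.2.symm)
    have hval : ∀ w, ((l j.1 - l v)⁻¹ • ((l : (Fin N → ℝ) →ₗ[ℝ] ℝ) ∘ₗ (vectorSpan ℝ P).subtype))
        (vertexDirection hv w) = (l w.1 - l v) / (l j.1 - l v) := fun w => by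
      simp [vertexDirection, div_eq_inv_mul]
    refine ⟨(l j.1 - l v)⁻¹ • ((l : (Fin N → ℝ) →ₗ[ℝ] ℝ) ∘ₗ (vectorSpan ℝ P).subtype),
      ?_, ?_, fun w hwj hwk => ?_⟩
    · rw [hval, div_self hpos.ne']
    · rw [hval, hjk, div_self hpos.ne']
    · rw [hval, div_lt_one hpos]
      have := hout w.1 w.2.1 (fun h => hwj (Subtype.ext h)) (fun h => hwk (Subtype.ext h))
      linarith

end VertexDirection

end Polytopes

/-- For every integer `d ≥ 4`, if `P` is a 2-neighborly `d`-polytope with at least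
`d + 3` vertices, then every vertex of `P` is contained in at least `d + 3` facets of `P`. -/
theorem two_neighborly_vertex_in_many_facets
    (d : ℕ) (hd : 4 ≤ d) {N : ℕ} (P : Set (Fin N → ℝ))
    (hP : IsPolytope P) (hdim : pdim P = d) (hnb : TwoNeighborly P)
    (hv : d + 3 ≤ (vertexSet P).ncard) :
    ∀ v : Fin N → ℝ, IsVertex P v →
      d + 3 ≤ {F : Set (Fin N → ℝ) | IsFacetOf P F ∧ v ∈ F}.ncard := by
  intro v hv_vertex
  have hfin : (vertexSet P).Finite := by
    rw [hP.vertexSet_eq]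
    exact hP.finite_extremePoints
  have hfinFacets : {F : Set (Fin N → ℝ) | IsFacetOf P F ∧ v ∈ F}.Finite :=
    hP.finite_isExposed.subset fun F hF => hF.1.1
  have : Fintype {w // IsVertex P w ∧ w ≠ v} := (hfin.sdiff (t := {v})).fintype
  have : Fintype {F // IsFacetOf P F ∧ v ∈ F} := hfinFacets.fintype
  choose ℓ hℓ using fun F : {F // IsFacetOf P F ∧ v ∈ F} =>
    F.2.1.1.exists_functional_vertexDirection hv_vertex F.2.2
  have hrank : Module.finrank ℝ (vectorSpan ℝ P) = d := by
    rw [← hdim, pdim, direction_affineSpan]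
  have hcardJ : d + 2 ≤ Fintype.card {w // IsVertex P w ∧ w ≠ v} := by
    have h1 : (vertexSet P \ {v}).ncard = Fintype.card {w // IsVertex P w ∧ w ≠ v} :=
      Nat.card_eq_fintype_card (α := {w // IsVertex P w ∧ w ≠ v})
    have h2 := ncard_sdiff_singleton_add_one (show v ∈ vertexSet P from hv_vertex) hfin
    omega
  have hcardI : {F : Set (Fin N → ℝ) | IsFacetOf P F ∧ v ∈ F}.ncard =
      Fintype.card {F // IsFacetOf P F ∧ v ∈ F} :=
    Nat.card_eq_fintype_card (α := {F // IsFacetOf P F ∧ v ∈ F})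
  have := (hnb.neighborlyCone hv_vertex hP hℓ).finrank_add_two_lt_card (by omega)
  omega
end

section
/- Let d ≥ 4, let P be a 2-neighborly d-polytope with n vertices, let v be a vertex of P, and let H be a hyperplane that strictly separates v from all other vertices of P. Then Q = P ∩ H is a (d−1)-polytope with exactly n−1 vertices which is 2-simplicial (every 2-dimensional face of Q has exactly 3 vertices). -/
open Set

/-- In a polytope, the vertices are exactly the extreme points; there are finitely many of them
and the polytope is their convex hull. -/
theorem IsPolytope.vertexSet_spec {N : ℕ} {P : Set (Fin N → ℝ)} (hP : IsPolytope P) :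
    vertexSet P = P.extremePoints ℝ ∧ (vertexSet P).Finite ∧ convexHull ℝ (vertexSet P) = P := by
  obtain ⟨S, rfl⟩ := hP
  set P := convexHull ℝ (S : Set (Fin N → ℝ)) with hPdef
  have hcomp : IsCompact P := S.finite_toSet.isCompact_convexHull ℝ
  have hconv : Convex ℝ P := convex_convexHull ℝ _
  have hfin : (P.extremePoints ℝ).Finite :=
    S.finite_toSet.subset extremePoints_convexHull_subset
  have hull : convexHull ℝ (P.extremePoints ℝ) = P := by
    rw [← (hfin.isClosed_convexHull ℝ).closure_eq]
    exact closure_convexHull_extremePoints hcomp hconv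
  have heq : vertexSet P = P.extremePoints ℝ := by
    ext x
    constructor
    · exact fun hx => IsExtreme.mem_extremePoints (IsExposed.isExtreme hx)
    · intro hx _
      have hx' := (hconv.mem_extremePoints_iff_mem_sdiff_convexHull_sdiff.1 hx)
      have hxD : x ∉ convexHull ℝ (P.extremePoints ℝ \ {x}) := fun h =>
        hx'.2 (convexHull_mono (sdiff_subset_sdiff_left extremePoints_subset) h)
      obtain ⟨f, r, hfr, hrx⟩ := geometric_hahn_banach_closed_point (convex_convexHull ℝ _)
        ((hfin.subset sdiff_subset).isClosed_convexHull ℝ) hxD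
      have hlt : ∀ y ∈ P, y ≠ x → f y < f x := by
        intro y hy hyx
        by_cases hD : (P.extremePoints ℝ \ {x}).Nonempty
        · have hy' : y ∈ convexHull ℝ (insert x (P.extremePoints ℝ \ {x})) := by
            rwa [insert_sdiff_singleton, insert_eq_of_mem hx, hull]
          rw [convexHull_insert hD, convexJoin_singleton_left] at hy'
          simp only [mem_iUnion] at hy'
          obtain ⟨z, hz, a, b, ha, hb, hab, rfl⟩ := hy'
          have hb' : 0 < b := by
            rcases hb.eq_or_lt with h | h
            · exfalso; apply hyx; subst h; simp at hab; simp [hab]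
            · exact h
          have := hfr z hz
          simp only [map_add, map_smul, smul_eq_mul]
          have : b * f z < b * f x := by gcongr; linarith
          have h1 : a * f x + b * f x = f x := by rw [← add_mul, hab, one_mul]
          linarith
        · exfalso
          rw [not_nonempty_iff_eq_empty] at hD
          have : P.extremePoints ℝ ⊆ {x} := sdiff_eq_empty.1 hD
          have hPx : P ⊆ {x} := by
            rw [← hull, ← convexHull_singleton (𝕜 := ℝ) x]
            exact convexHull_mono this
          exact hyx (hPx hy)
      refine ⟨f, Subset.antisymm ?_ ?_⟩
      · rintro y rfl
        exact ⟨hx.1, fun z hz => by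
          by_cases h : z = y
          · rw [h]
          · exact (hlt z hz h).le⟩
      · rintro y ⟨hy, hy'⟩
        by_contra h
        exact absurd (hy' x hx.1) (not_le.2 (hlt y hy h))
  exact ⟨heq, heq ▸ hfin, heq ▸ hull⟩

/-- A nonempty exposed face of a polytope is the convex hull of the vertices it contains, and
these are the vertices of the face. -/
theorem IsPolytope.convexHull_vertexSet_face {N : ℕ} {P F : Set (Fin N → ℝ)} (hP : IsPolytope P)
    (hF : IsExposed ℝ P F) :
    vertexSet F ⊆ vertexSet P ∧ convexHull ℝ (vertexSet F) = F := by
  obtain ⟨heq, hfin, -⟩ := hP.vertexSet_spec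
  have hcomp : IsCompact P := by
    obtain ⟨S, rfl⟩ := hP
    exact S.finite_toSet.isCompact_convexHull ℝ
  have hconv : Convex ℝ P := by
    obtain ⟨S, rfl⟩ := hP
    exact convex_convexHull ℝ _
  have hsub : F.extremePoints ℝ ⊆ vertexSet P := by
    rw [heq]
    exact hF.isExtreme.extremePoints_subset_extremePoints
  have hv : vertexSet F = F.extremePoints ℝ := by
    refine Subset.antisymm
      (fun x hx => IsExtreme.mem_extremePoints (IsExposed.isExtreme hx)) fun x hx => ?_
    exact IsExposed.mono (hsub hx) hF.subset (singleton_subset_iff.2 hx.1)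
  refine ⟨hv ▸ hsub, ?_⟩
  rw [hv, ← ((hfin.subset hsub).isClosed_convexHull ℝ).closure_eq]
  exact closure_convexHull_extremePoints (hF.isCompact hcomp) (hF.convex hconv)

/-- If the convex hull of `A` is a face of `P`, it misses the convex hull of any set of vertices
disjoint from `A`. -/
theorem disjoint_convexHull_of_isExposed {N : ℕ} {P A B : Set (Fin N → ℝ)}
    (hA : IsExposed ℝ P (convexHull ℝ A)) (hB : B ⊆ vertexSet P) (hAB : Disjoint A B) :
    Disjoint (convexHull ℝ A) (convexHull ℝ B) := by
  rw [Set.disjoint_left]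
  intro x hxA hxB
  obtain ⟨g, hg⟩ := hA ⟨x, hxA⟩
  have hx := hxA
  rw [hg] at hx
  have hlt : B ⊆ {y | g y < g x} := by
    intro b hb
    have hbv : IsExposed ℝ P {b} := hB hb
    have hbP : b ∈ P := hbv.subset rfl
    by_contra hge
    have hbA : b ∈ convexHull ℝ A := by
      rw [hg]
      exact ⟨hbP, fun y hy => (hx.2 y hy).trans (not_lt.1 hge)⟩
    have hext : b ∈ (convexHull ℝ A).extremePoints ℝ :=
      inter_extremePoints_subset_extremePoints_of_subset hA.subset
        ⟨hbA, hbv.isExtreme.mem_extremePoints⟩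
    exact Set.disjoint_left.1 hAB (extremePoints_convexHull_subset hext) hb
  have hxx : g x < g x := convexHull_min hlt (convex_halfSpace_lt g.isLinear (g x)) hxB
  exact hxx.false

/-- Any five (or fewer) vertices of a 2-neighborly polytope are affinely independent. -/
theorem TwoNeighborly.affineIndependent {N : ℕ} {P : Set (Fin N → ℝ)} (hnb : TwoNeighborly P)
    (A : Finset (Fin N → ℝ)) (hA : (A : Set (Fin N → ℝ)) ⊆ vertexSet P) (hcard : A.card ≤ 5) :
    AffineIndependent ℝ ((↑) : A → (Fin N → ℝ)) := by
  classical
  have key : ∀ I J : Finset (Fin N → ℝ), I ⊆ A → J ⊆ A → Disjoint I J → I.card ≤ 2 →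
      Disjoint (convexHull ℝ (I : Set (Fin N → ℝ))) (convexHull ℝ (J : Set (Fin N → ℝ))) := by
    intro I J hI hJ hIJ hc
    refine disjoint_convexHull_of_isExposed (P := P) ?_
      ((Finset.coe_subset.2 hJ).trans hA) (Finset.disjoint_coe.2 hIJ)
    interval_cases h : I.card
    · rw [Finset.card_eq_zero.1 h]
      simpa using isExposed_empty
    · obtain ⟨a, rfl⟩ := Finset.card_eq_one.1 h
      simpa [vertexSet, IsVertex] using hA (hI (Finset.mem_singleton_self a))
    · obtain ⟨a, b, hab, rfl⟩ := Finset.card_eq_two.1 h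
      simpa using (hnb a b (hA (hI (by simp))) (hA (hI (by simp))) hab).1
  by_contra h
  obtain ⟨I, x, hx₁, hx₂⟩ := Convex.radon_partition h
  set J : Finset (Fin N → ℝ) := A.filter fun a => ∃ h : a ∈ A, (⟨a, h⟩ : A) ∈ I with hJ
  have h₁ : ((↑) : A → (Fin N → ℝ)) '' I = (J : Set (Fin N → ℝ)) := by
    ext a; simp [hJ]
  have h₂ : ((↑) : A → (Fin N → ℝ)) '' Iᶜ = ((A \ J : Finset _) : Set (Fin N → ℝ)) := by
    ext a; simp [hJ]; grind
  rw [h₁] at hx₁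
  rw [h₂] at hx₂
  have hJA : J ⊆ A := Finset.filter_subset _ _
  have hsum := Finset.card_sdiff_add_card_eq_card hJA
  rcases le_or_gt J.card 2 with hc | hc
  · exact Set.disjoint_left.1 (key J (A \ J) hJA Finset.sdiff_subset Finset.disjoint_sdiff hc)
      hx₁ hx₂
  · exact Set.disjoint_left.1 (key (A \ J) J Finset.sdiff_subset hJA Finset.sdiff_disjoint
      (by omega)) hx₂ hx₁

/-- Adding a point off a hyperplane to a nonempty subset of the hyperplane raises the dimension
by one. -/
theorem pdim_insert_of_notMem_hyperplane {N : ℕ} {X : Set (Fin N → ℝ)} (hX : X.Nonempty)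
    {v : Fin N → ℝ} {l : (Fin N → ℝ) →L[ℝ] ℝ} {c : ℝ} (hXl : ∀ x ∈ X, l x = c) (hv : l v ≠ c) :
    pdim (insert v X) = pdim X + 1 := by
  obtain ⟨x, hx⟩ := hX
  have hker : (affineSpan ℝ X).direction ≤ LinearMap.ker (l : (Fin N → ℝ) →ₗ[ℝ] ℝ) := by
    rw [direction_affineSpan, vectorSpan_def, Submodule.span_le]
    rintro _ ⟨a, ha, b, hb, rfl⟩
    simp [hXl a ha, hXl b hb]
  have hlv : l (v - x) ≠ 0 := by
    rw [map_sub, hXl x hx]; exact sub_ne_zero.2 hv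
  have hinf : Submodule.span ℝ {v - x} ⊓ (affineSpan ℝ X).direction = ⊥ := by
    rw [eq_bot_iff]
    rintro y ⟨hy₁, hy₂⟩
    obtain ⟨a, rfl⟩ := Submodule.mem_span_singleton.1 hy₁
    have h0 : l (a • (v - x)) = 0 := hker hy₂
    rw [map_smul, smul_eq_mul] at h0
    rcases mul_eq_zero.1 h0 with h | h
    · simp [h]
    · exact absurd h hlv
  have hne : v - x ≠ 0 := fun h => hlv (by rw [h, map_zero])
  have hdim := Submodule.finrank_sup_add_finrank_inf_eq
    (Submodule.span ℝ {v - x}) (affineSpan ℝ X).direction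
  rw [hinf, finrank_bot, finrank_span_singleton hne] at hdim
  unfold pdim
  rw [← affineSpan_insert_affineSpan,
    AffineSubspace.direction_affineSpan_insert (mem_affineSpan ℝ hx), vsub_eq_sub]
  omega

theorem pdim_convexHull {N : ℕ} (X : Set (Fin N → ℝ)) : pdim (convexHull ℝ X) = pdim X := by
  unfold pdim
  rw [affineSpan_convexHull]

theorem pdim_mono {N : ℕ} {X Y : Set (Fin N → ℝ)} (h : X ⊆ affineSpan ℝ Y) : pdim X ≤ pdim Y :=
  Submodule.finrank_mono (AffineSubspace.direction_le (affineSpan_le.2 h))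

/-- A finite nonempty set of `k` points has dimension less than `k`. -/
theorem pdim_lt_ncard {N : ℕ} {X : Set (Fin N → ℝ)} (hX : X.Finite) (hne : X.Nonempty) :
    pdim X < X.ncard := by
  classical
  lift X to Finset (Fin N → ℝ) using hX
  rw [ncard_coe_finset]
  have hpos : 0 < X.card := Finset.card_pos.2 (Finset.coe_nonempty.1 hne)
  have := finrank_vectorSpan_image_finset_le ℝ (id : (Fin N → ℝ) → _) X
    (n := X.card - 1) (by omega)
  rw [Finset.image_id] at this
  unfold pdim
  rw [direction_affineSpan]
  omega

/-- The point at which the line through `v` and `w` meets the hyperplane `{x | l x = c}`. -/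
noncomputable def hyperplanePoint {N : ℕ} (l : (Fin N → ℝ) →L[ℝ] ℝ) (c : ℝ) (v w : Fin N → ℝ) :
    Fin N → ℝ :=
  AffineMap.lineMap v w ((c - l v) / (l w - l v))

section hyperplanePoint

variable {N : ℕ} {l : (Fin N → ℝ) →L[ℝ] ℝ} {c : ℝ} {v : Fin N → ℝ}

theorem apply_hyperplanePoint {w : Fin N → ℝ} (hv : l v < c) (hw : c < l w) :
    l (hyperplanePoint l c v w) = c := by
  have : l w - l v ≠ 0 := by linarith
  simp only [hyperplanePoint, AffineMap.lineMap_apply, vsub_eq_sub, vadd_eq_add, map_add, map_smul,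
    map_sub, smul_eq_mul]
  field_simp
  ring

theorem hyperplanePoint_mem_openSegment {w : Fin N → ℝ} (hv : l v < c) (hw : c < l w) :
    hyperplanePoint l c v w ∈ openSegment ℝ v w := by
  rw [openSegment_eq_image_lineMap]
  refine ⟨_, ⟨?_, ?_⟩, rfl⟩
  · exact div_pos (by linarith) (by linarith)
  · rw [div_lt_one (by linarith)]; linarith

theorem hyperplanePoint_mem_affineSpan_pair (w : Fin N → ℝ) :
    hyperplanePoint l c v w ∈ affineSpan ℝ {v, w} :=
  AffineMap.lineMap_mem_affineSpan_pair _ _ _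

theorem lineMap_hyperplanePoint {w : Fin N → ℝ} (hv : l v < c) (hw : c < l w) :
    w = AffineMap.lineMap v (hyperplanePoint l c v w) ((l w - l v) / (c - l v)) := by
  have h₁ : l w - l v ≠ 0 := by linarith
  have h₂ : c - l v ≠ 0 := by linarith
  simp only [hyperplanePoint, AffineMap.lineMap_apply, vsub_eq_sub, vadd_eq_add,
    add_sub_cancel_right, smul_smul, div_mul_div_cancel₀ h₂, div_self h₁, one_smul, sub_add_cancel]

theorem pdim_insert_image_hyperplanePoint {W : Set (Fin N → ℝ)} (hv : l v < c)
    (hW : ∀ w ∈ W, c < l w) :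
    pdim (insert v (hyperplanePoint l c v '' W)) = pdim (insert v W) := by
  apply le_antisymm
  · refine pdim_mono (insert_subset (mem_affineSpan ℝ (mem_insert _ _)) ?_)
    rintro _ ⟨w, hw, rfl⟩
    exact affineSpan_mono ℝ (insert_subset_insert (singleton_subset_iff.2 hw))
      (hyperplanePoint_mem_affineSpan_pair w)
  · refine pdim_mono (insert_subset (mem_affineSpan ℝ (mem_insert _ _)) fun w hw => ?_)
    rw [SetLike.mem_coe, lineMap_hyperplanePoint hv (hW w hw)]
    exact AffineMap.lineMap_mem _ (mem_affineSpan ℝ (mem_insert _ _))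
      (mem_affineSpan ℝ (mem_insert_of_mem _ (mem_image_of_mem _ hw)))

/-- A hyperplane section separating `v` from `W` is spanned by its points on the segments from `v`
to the points of `W`. -/
theorem convexHull_insert_inter_hyperplane {W : Set (Fin N → ℝ)} (hne : W.Nonempty) (hv : l v < c)
    (hW : ∀ w ∈ W, c < l w) :
    convexHull ℝ (insert v W) ∩ {x | l x = c} = convexHull ℝ (hyperplanePoint l c v '' W) := by
  set C := convexHull ℝ (hyperplanePoint l c v '' W) with hC
  have hCl : C ⊆ {x | l x = c} := by
    refine convexHull_min ?_ (convex_hyperplane l.isLinear c)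
    rintro _ ⟨w, hw, rfl⟩
    exact apply_hyperplanePoint hv (hW w hw)
  apply Subset.antisymm
  · rintro x ⟨hx, hxc⟩
    have hK : convexHull ℝ W ⊆ {x | ∃ s : ℝ, 0 < s ∧ ∃ y ∈ C, x = v + s • (y - v)} := by
      refine convexHull_min (fun w hw => ?_) ?_
      · refine ⟨(l w - l v) / (c - l v), ?_, hyperplanePoint l c v w,
          subset_convexHull ℝ _ (mem_image_of_mem _ hw), ?_⟩
        · have := hW w hw
          exact div_pos (by linarith) (by linarith)
        · conv_lhs => rw [lineMap_hyperplanePoint hv (hW w hw)]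
          rw [AffineMap.lineMap_apply, vsub_eq_sub, vadd_eq_add, add_comm]
      · rintro _ ⟨s₁, hs₁, y₁, hy₁, rfl⟩ _ ⟨s₂, hs₂, y₂, hy₂, rfl⟩ a b ha hb hab
        have hpos : 0 < a * s₁ + b * s₂ := by
          rcases ha.eq_or_lt with rfl | ha'
          · have : b = 1 := by linarith
            simpa [this] using hs₂
          · have := mul_pos ha' hs₁
            have := mul_nonneg hb hs₂.le
            linarith
        refine ⟨a * s₁ + b * s₂, hpos, (a * s₁ / (a * s₁ + b * s₂)) • y₁ +
          (b * s₂ / (a * s₁ + b * s₂)) • y₂, convex_convexHull ℝ _ hy₁ hy₂ (by positivity)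
          (by positivity) (by field_simp), ?_⟩
        ext i
        simp only [Pi.add_apply, Pi.smul_apply, Pi.sub_apply, smul_eq_mul]
        obtain rfl : b = 1 - a := by linarith
        field_simp
        ring
    rw [convexHull_insert hne, convexJoin_singleton_left] at hx
    simp only [mem_iUnion] at hx
    obtain ⟨z, hz, hx⟩ := hx
    obtain ⟨s, hs, y, hy, rfl⟩ := hK hz
    rw [segment_eq_image'] at hx
    obtain ⟨t, ht, rfl⟩ := hx
    have hyc : l y = c := hCl hy
    have hval : (t * s) * (c - l v) = c - l v := by
      have : l (v + t • (v + s • (y - v) - v)) = c := hxc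
      simp only [map_add, map_smul, map_sub, smul_eq_mul, hyc] at this
      linarith
    have hts : t * s = 1 := mul_right_cancel₀ (b := c - l v) (by linarith) (by rw [hval, one_mul])
    have hxy : v + t • (v + s • (y - v) - v) = y := by
      rw [add_sub_cancel_left, smul_smul, hts, one_smul, add_sub_cancel]
    change v + t • (v + s • (y - v) - v) ∈ C
    rwa [hxy]
  · refine subset_inter (convexHull_min ?_ (convex_convexHull ℝ _)) hCl
    rintro _ ⟨w, hw, rfl⟩
    exact segment_subset_convexHull (mem_insert _ _) (mem_insert_of_mem _ hw)
      (openSegment_subset_segment _ _ _ (hyperplanePoint_mem_openSegment hv (hW w hw)))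

end hyperplanePoint

/-- The section of a face by a set is a face of the section of the polytope. -/
theorem IsExposed.inter_section {N : ℕ} {P F : Set (Fin N → ℝ)} (hF : IsExposed ℝ P F)
    (H : Set (Fin N → ℝ)) : IsExposed ℝ (P ∩ H) (F ∩ H) := by
  rintro ⟨x, hxF, hxH⟩
  obtain ⟨g, rfl⟩ := hF ⟨x, hxF⟩
  refine ⟨g, Subset.antisymm (fun y hy => ⟨⟨hy.1.1, hy.2⟩, fun z hz => hy.1.2 z hz.1⟩)
    fun y hy => ?_⟩
  exact ⟨⟨hy.1.1, fun z hz => (hxF.2 z hz).trans (hy.2 x ⟨hxF.1, hxH⟩)⟩, hy.1.2⟩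

/-- The vertex figure of a 2-neighborly `d`-polytope with `n` vertices (the
intersection of `P` with a hyperplane `{x | l x = c}` strictly separating one vertex `v` from all
the other vertices) is a 2-simplicial `(d - 1)`-polytope with exactly `n - 1` vertices. -/
theorem vertex_figure_two_simplicial
    (d n : ℕ) (hd : 4 ≤ d) {N : ℕ} (P : Set (Fin N → ℝ))
    (hP : IsPolytope P) (hdim : pdim P = d) (hnb : TwoNeighborly P)
    (hn : (vertexSet P).ncard = n)
    (v : Fin N → ℝ) (hv : IsVertex P v)
    (l : (Fin N → ℝ) →L[ℝ] ℝ) (c : ℝ)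
    (hsep₁ : l v < c) (hsep₂ : ∀ w ∈ vertexSet P, w ≠ v → c < l w) :
    IsPolytope (P ∩ {x | l x = c}) ∧
    pdim (P ∩ {x | l x = c}) = d - 1 ∧
    (vertexSet (P ∩ {x | l x = c})).ncard = n - 1 ∧
    TwoSimplicial (P ∩ {x | l x = c}) := by
  classical
  obtain ⟨hVe, hVfin, hVhull⟩ := hP.vertexSet_spec
  set W := vertexSet P \ {v} with hW
  set q := hyperplanePoint l c v with hq
  set Q := P ∩ {x | l x = c} with hQ
  have hWl : ∀ w ∈ W, c < l w := fun w hw => hsep₂ w hw.1 hw.2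
  have hWfin : W.Finite := hVfin.subset sdiff_subset
  have hVW : insert v W = vertexSet P := by
    rw [hW, insert_sdiff_singleton, insert_eq_of_mem hv]
  have hPdim : pdim (insert v W) = d := by rw [hVW, ← pdim_convexHull, hVhull, hdim]
  have hWne : W.Nonempty := by
    rw [nonempty_iff_ne_empty]
    intro h0
    have := pdim_lt_ncard (X := insert v W) (hWfin.insert v) (insert_nonempty _ _)
    rw [hPdim, h0, insert_empty_eq, ncard_singleton] at this
    omega
  have hQhull : Q = convexHull ℝ (q '' W) := by
    rw [hQ, ← hVhull, ← hVW]
    exact convexHull_insert_inter_hyperplane hWne hsep₁ hWl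
  have hql : ∀ x ∈ q '' W, l x = c := by
    rintro _ ⟨w, hw, rfl⟩
    exact apply_hyperplanePoint hsep₁ (hWl w hw)
  have hQpoly : IsPolytope Q := ⟨(hWfin.image q).toFinset, by rw [Finite.coe_toFinset, hQhull]⟩
  have hedge : ∀ w ∈ W, IsExposed ℝ P (convexHull ℝ {v, w}) := fun w hw =>
    (hnb v w hv hw.1 (Ne.symm hw.2)).1
  have hqmem : ∀ w ∈ W, q w ∈ convexHull ℝ {v, w} := fun w hw => by
    rw [convexHull_pair]
    exact openSegment_subset_segment _ _ _ (hyperplanePoint_mem_openSegment hsep₁ (hWl w hw))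
  have hqvert : ∀ w ∈ W, IsVertex Q (q w) := by
    intro w hw
    have hface : IsExposed ℝ Q (convexHull ℝ {v, w} ∩ {x | l x = c}) :=
      (hedge w hw).inter_section _
    have := convexHull_insert_inter_hyperplane (singleton_nonempty w) hsep₁
      (by simpa using hWl w hw)
    rw [image_singleton, convexHull_singleton] at this
    rwa [this] at hface
  have hQvert : vertexSet Q = q '' W := by
    apply Subset.antisymm
    · rw [hQpoly.vertexSet_spec.1, hQhull]
      exact extremePoints_convexHull_subset
    · rintro _ ⟨w, hw, rfl⟩
      exact hqvert w hw
  have hqinj : InjOn q W := by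
    intro w hw w' hw' heq
    have hq' := hyperplanePoint_mem_openSegment hsep₁ (hWl w' hw')
    have hqw : q w' ∈ convexHull ℝ {v, w} := heq ▸ hqmem w hw
    have hmem : w' ∈ convexHull ℝ {v, w} :=
      (hedge w hw).isExtreme.right_mem_of_mem_openSegment
        (IsExposed.subset hv rfl) (IsExposed.subset hw'.1 rfl) hqw hq'
    by_contra hne
    refine Set.disjoint_left.1 (disjoint_convexHull_of_isExposed (B := {w'}) (hedge w hw)
      (singleton_subset_iff.2 hw'.1) ?_) hmem (subset_convexHull ℝ _ rfl)
    rw [disjoint_singleton_right]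
    rintro (h | h)
    · exact hw'.2 h
    · exact hne h.symm
  refine ⟨hQpoly, ?_, ?_, ?_⟩
  · have := pdim_insert_of_notMem_hyperplane (hWne.image q) hql hsep₁.ne
    rw [hq, pdim_insert_image_hyperplanePoint hsep₁ hWl, hPdim, ← hq] at this
    rw [hQhull, pdim_convexHull]
    omega
  · rw [hQvert, hqinj.ncard_image, hW, ncard_sdiff_singleton_of_mem hv, hn]
  · intro F hF hFne hF2
    obtain ⟨hFsub, hFhull⟩ := hQpoly.convexHull_vertexSet_face hF
    have hUfin : (vertexSet F).Finite := (hWfin.image q).subset (hQvert ▸ hFsub)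
    have hUne : (vertexSet F).Nonempty := by
      rwa [← convexHull_nonempty_iff (𝕜 := ℝ), hFhull]
    have hUdim : pdim (vertexSet F) = 2 := by rw [← pdim_convexHull, hFhull, hF2]
    have hge := pdim_lt_ncard hUfin hUne
    obtain ⟨W', hW'W, hW'U⟩ := subset_image_iff.1 (hQvert ▸ hFsub)
    have hle : (vertexSet F).ncard ≤ 3 := by
      by_contra! h4
      rw [← hW'U, (hqinj.mono hW'W).ncard_image] at h4
      obtain ⟨A, hAW', hA⟩ := exists_subset_card_eq h4
      have hAfin : A.Finite := finite_of_ncard_ne_zero (by omega)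
      have hAV : insert v A ⊆ vertexSet P := by
        rw [← hVW]
        exact insert_subset_insert (hAW'.trans hW'W)
      have hvA : v ∉ A := fun h => (hW'W (hAW' h)).2 rfl
      have hcard : (insert v A).ncard = 5 := by
        rw [ncard_insert_of_notMem hvA hAfin, hA]
      lift A to Finset (Fin N → ℝ) using hAfin
      rw [← Finset.coe_insert, ncard_coe_finset] at hcard
      rw [← Finset.coe_insert] at hAV
      have hind := (hnb.affineIndependent (insert v A) hAV hcard.le).finrank_vectorSpan
        (n := 4) (by simpa using hcard)
      rw [Subtype.range_coe_subtype] at hind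
      have hAdim : pdim (insert v (A : Set (Fin N → ℝ))) = 4 := by
        rw [← hind, ← Finset.coe_insert]
        unfold pdim
        rw [direction_affineSpan]
        rfl
      have hmono : pdim (insert v (A : Set (Fin N → ℝ))) ≤ pdim (insert v W') :=
        pdim_mono ((insert_subset_insert hAW').trans (subset_affineSpan ℝ _))
      have hins := pdim_insert_of_notMem_hyperplane (X := q '' W') (hW'U ▸ hUne)
        (fun x hx => hql x (image_mono hW'W hx)) hsep₁.ne
      rw [hq, pdim_insert_image_hyperplanePoint hsep₁ (fun w hw => hWl w (hW'W hw)), ← hq, hW'U,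
        hUdim] at hins
      omega
    omega
end
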